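/- arXiv:2005.01829 — 3 statements merged into one kernel-verified Lean document; each statement's English description precedes it below -/
import Mathlib

section
/- Let n ≥ 2 and t ≥ 1 be integers, and let n = r₁ + r₂ + ... + r_t be a partition of n where each rᵢ ≥ 2. Then the set {1, 2, ..., n} can be partitioned into pairwise disjoint subsets R₁, ..., R_t such that |Rᵢ| = rᵢ for each i, and the sum of the elements of each Rᵢ is congruent to 0 modulo n+1 if n is even, and congruent to 0 modulo n if n is odd. -/
/-- A finite set that is large enough contains disjoint subsets of prescribed sizes. -/
theorem exists_disjoint_subsets {ι α : Type*} [DecidableEq ι] [DecidableEq α] (v : ι → ℕ)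
    (s : Finset ι) :
    ∀ U : Finset α, ∑ i ∈ s, v i ≤ U.card →
      ∃ V : ι → Finset α, (∀ i ∈ s, V i ⊆ U) ∧ (∀ i ∈ s, (V i).card = v i) ∧
        (∀ i ∈ s, ∀ j ∈ s, i ≠ j → Disjoint (V i) (V j)) := by
  induction s using Finset.induction_on with
  | empty => intro U _; exact ⟨fun _ => ∅, by simp, by simp, by simp⟩
  | insert a s ha ih =>
    intro U hU
    rw [Finset.sum_insert ha] at hU
    obtain ⟨W, hWU, hW⟩ := Finset.exists_subset_card_eq (s := U) (n := v a) (by omega)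
    have hc : (U \ W).card = U.card - v a := by rw [Finset.card_sdiff_of_subset hWU, hW]
    obtain ⟨V, h1, h2, h3⟩ := ih (U \ W) (by omega)
    have hne : ∀ i ∈ s, i ≠ a := fun i hi h => ha (h ▸ hi)
    have hd : ∀ i ∈ s, Disjoint (V i) W := fun i hi =>
      Finset.disjoint_of_subset_left (h1 i hi) Finset.sdiff_disjoint
    refine ⟨fun i => if i = a then W else V i, ?_, ?_, ?_⟩
    · intro i hi
      by_cases h : i = a
      · simpa [h] using hWU
      · simp only [h, if_false]
        exact (h1 i (Finset.mem_of_mem_insert_of_ne hi h)).trans Finset.sdiff_subset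
    · intro i hi
      by_cases h : i = a
      · simpa [h] using hW
      · simp only [h, if_false]
        exact h2 i (Finset.mem_of_mem_insert_of_ne hi h)
    · intro i hi j hj hij
      by_cases h : i = a
      · have hj' : j ≠ a := fun h' => hij (h.trans h'.symm)
        simp only [h, hj', if_true, if_false]
        exact (hd j (Finset.mem_of_mem_insert_of_ne hj hj')).symm
      · by_cases h' : j = a
        · simp only [h, h', if_true, if_false]
          exact hd i (Finset.mem_of_mem_insert_of_ne hi h)
        · simp only [h, h', if_false]
          exact h3 i (Finset.mem_of_mem_insert_of_ne hi h) j
            (Finset.mem_of_mem_insert_of_ne hj h') hij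

/-- The small element of the `y`-th triple. -/
def smallElt (k y : ℤ) : ℤ := if y ≤ k then y else y - 2 * k - 1

/-- The `y`-th zero-sum triple in `{±1, …, ±3k}`, `1 ≤ y ≤ 2k`. -/
def triple (k y : ℤ) : Finset ℤ := {smallElt k y, y + k, -(smallElt k y + y + k)}

theorem triple_card (k y : ℤ) (h1 : 1 ≤ y) (h2 : y ≤ 2 * k) : (triple k y).card = 3 := by
  unfold triple
  rw [Finset.card_eq_three]
  refine ⟨_, _, _, ?_, ?_, ?_, rfl⟩ <;> unfold smallElt <;> split_ifs <;> omega

theorem triple_sum (k y : ℤ) (h1 : 1 ≤ y) (h2 : y ≤ 2 * k) : ∑ x ∈ triple k y, x = 0 := by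
  unfold triple
  rw [Finset.sum_insert, Finset.sum_insert, Finset.sum_singleton]
  · ring
  · simp only [Finset.mem_singleton]
    unfold smallElt; split_ifs <;> omega
  · simp only [Finset.mem_singleton, Finset.mem_insert]
    unfold smallElt; split_ifs <;> omega

theorem triple_mem (k y x : ℤ) (h1 : 1 ≤ y) (h2 : y ≤ 2 * k) (hx : x ∈ triple k y) :
    x ≠ 0 ∧ -(3 * k) ≤ x ∧ x ≤ 3 * k := by
  unfold triple smallElt at hx
  simp only [Finset.mem_singleton, Finset.mem_insert] at hx
  split_ifs at hx <;> omega

theorem triple_disjoint (k y z : ℤ) (h1 : 1 ≤ y) (h2 : y ≤ 2 * k) (h3 : 1 ≤ z) (h4 : z ≤ 2 * k)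
    (hyz : y ≠ z) : Disjoint (triple k y) (triple k z) := by
  rw [Finset.disjoint_left]
  intro x hx hx'
  unfold triple smallElt at hx hx'
  simp only [Finset.mem_singleton, Finset.mem_insert] at hx hx'
  split_ifs at hx hx' <;> omega

/-- Zero-sum partition of `{±1, …, ±h}` in the integers. -/
theorem int_partition (h t : ℕ) (r : Fin t → ℕ) (hr : ∀ i, 2 ≤ r i) (hsum : ∑ i, r i = 2 * h) :
    ∃ R : Fin t → Finset ℤ,
      (∀ i j, i ≠ j → Disjoint (R i) (R j)) ∧
      (∀ i, ∀ x ∈ R i, x ≠ 0 ∧ -(h : ℤ) ≤ x ∧ x ≤ h) ∧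
      (∀ i, (R i).card = r i) ∧
      (∀ i, ∑ x ∈ R i, x = 0) := by
  classical
  let O : Finset (Fin t) := Finset.univ.filter fun i => r i % 2 = 1
  let v : Fin t → ℕ := fun i => if r i % 2 = 1 then (r i - 3) / 2 else r i / 2
  have hrv : ∀ i, r i = 2 * v i + (if r i % 2 = 1 then 3 else 0) := by
    intro i
    have := hr i
    simp only [v]
    split_ifs <;> omega
  have hO : ∑ i, r i = 2 * ∑ i, v i + 3 * O.card := by
    rw [Finset.sum_congr rfl fun i _ => hrv i, Finset.sum_add_distrib, ← Finset.mul_sum,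
      ← Finset.sum_filter, Finset.sum_const, smul_eq_mul, mul_comm O.card]
  obtain ⟨k, hk⟩ : ∃ k, O.card = 2 * k := ⟨O.card / 2, by omega⟩
  have e := O.equivFinOfCardEq hk
  let y : Fin t → ℤ := fun i => if hi : i ∈ O then ((e ⟨i, hi⟩ : ℕ) : ℤ) + 1 else 0
  have hmem : ∀ i, i ∈ O ↔ r i % 2 = 1 := by intro i; simp [O]
  have hy : ∀ i, r i % 2 = 1 → 1 ≤ y i ∧ y i ≤ 2 * k := by
    intro i hi
    rw [← hmem] at hi
    have := (e ⟨i, hi⟩).2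
    simp only [y, hi, dif_pos]
    omega
  have hyinj : ∀ i j, r i % 2 = 1 → r j % 2 = 1 → i ≠ j → y i ≠ y j := by
    intro i j hi hj hij heq
    rw [← hmem] at hi hj
    simp only [y, hi, hj, dif_pos] at heq
    have h1 : e ⟨i, hi⟩ = e ⟨j, hj⟩ := Fin.ext (by omega)
    have h2 := e.injective h1
    exact hij (by simpa using h2)
  obtain ⟨V, hV1, hV2, hV3⟩ := exists_disjoint_subsets v Finset.univ
    (Finset.Icc (3 * k + 1 : ℤ) h) (by rw [Int.card_Icc]; omega)
  have hVm : ∀ i, ∀ x ∈ V i, 3 * (k : ℤ) + 1 ≤ x ∧ x ≤ h := by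
    intro i x hx
    simpa using hV1 i (Finset.mem_univ i) hx
  have hkh : 3 * k ≤ h := by omega
  let N : Fin t → Finset ℤ := fun i => (V i).image (fun x => -x)
  have hNm : ∀ i x, x ∈ N i ↔ -x ∈ V i := by
    intro i x
    simp only [N, Finset.mem_image]
    constructor
    · rintro ⟨a, ha, rfl⟩; simpa using ha
    · intro hx; exact ⟨-x, hx, by simp⟩
  let T : Fin t → Finset ℤ := fun i => if r i % 2 = 1 then triple k (y i) else ∅
  have hTm : ∀ i, ∀ x ∈ T i, x ≠ 0 ∧ -(3 * (k : ℤ)) ≤ x ∧ x ≤ 3 * k := by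
    intro i x hx
    simp only [T] at hx
    split_ifs at hx with hi
    · exact triple_mem k (y i) x (hy i hi).1 (hy i hi).2 hx
    · simp at hx
  have hTd : ∀ i j, i ≠ j → Disjoint (T i) (T j) := by
    intro i j hij
    simp only [T]
    split_ifs with hi hj
    · exact triple_disjoint k _ _ (hy i hi).1 (hy i hi).2 (hy j hj).1 (hy j hj).2
        (hyinj i j hi hj hij)
    all_goals simp
  have hVN : ∀ i, Disjoint (V i) (N i) := by
    intro i
    rw [Finset.disjoint_left]
    intro x hx hx'
    have h1 := hVm i x hx
    have h2 := hVm i _ ((hNm i x).1 hx')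
    omega
  have hTVN : ∀ i, Disjoint (T i) (V i ∪ N i) := by
    intro i
    rw [Finset.disjoint_left]
    intro x hx hx'
    have h0 := hTm i x hx
    rcases Finset.mem_union.1 hx' with h | h
    · have h1 := hVm i x h
      omega
    · have h2 := hVm i _ ((hNm i x).1 h)
      omega
  refine ⟨fun i => T i ∪ (V i ∪ N i), ?_, ?_, ?_, ?_⟩
  · intro i j hij
    rw [Finset.disjoint_left]
    intro x hx hx'
    have hVd := hV3 i (Finset.mem_univ i) j (Finset.mem_univ j) hij
    have d1 : x ∈ T i → x ∉ T j := fun hm => Finset.disjoint_left.1 (hTd i j hij) hm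
    have d2 : x ∈ V i → x ∉ V j := fun hm => Finset.disjoint_left.1 hVd hm
    have d3 : -x ∈ V i → -x ∉ V j := fun hm => Finset.disjoint_left.1 hVd hm
    simp only [Finset.mem_union, hNm] at hx hx'
    have a1 := hTm i x
    have a2 := hVm i x
    have a3 := hVm i (-x)
    have b1 := hTm j x
    have b2 := hVm j x
    have b3 := hVm j (-x)
    rcases hx with hx | hx | hx <;> rcases hx' with hx' | hx' | hx'
    · exact d1 hx hx'
    · have := a1 hx; have := b2 hx'; omega
    · have := a1 hx; have := b3 hx'; omega
    · have := a2 hx; have := b1 hx'; omega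
    · exact d2 hx hx'
    · have := a2 hx; have := b3 hx'; omega
    · have := a3 hx; have := b1 hx'; omega
    · have := a3 hx; have := b2 hx'; omega
    · exact d3 hx hx'
  · intro i x hx
    simp only [Finset.mem_union, hNm] at hx
    rcases hx with hx | hx | hx
    · have := hTm i x hx
      omega
    · have := hVm i x hx
      omega
    · have := hVm i _ hx
      omega
  · intro i
    have hN : (N i).card = v i := by
      simp only [N]
      rw [Finset.card_image_of_injective _ neg_injective, hV2 i (Finset.mem_univ i)]
    rw [Finset.card_union_of_disjoint (hTVN i), Finset.card_union_of_disjoint (hVN i), hN,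
      hV2 i (Finset.mem_univ i)]
    have h1 := hrv i
    simp only [T]
    split_ifs at h1 ⊢ with hi
    · rw [triple_card k _ (hy i hi).1 (hy i hi).2]; omega
    · rw [Finset.card_empty]; omega
  · intro i
    have hN : ∑ x ∈ N i, x = - ∑ x ∈ V i, x := by
      simp only [N]
      rw [Finset.sum_image (fun a _ b _ hab => neg_injective hab), Finset.sum_neg_distrib]
    have hT : ∑ x ∈ T i, x = 0 := by
      simp only [T]
      split_ifs with hi
      · exact triple_sum k _ (hy i hi).1 (hy i hi).2
      · simp
    rw [Finset.sum_union (hTVN i), Finset.sum_union (hVN i), hN, hT]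
    ring

/-- Reduction of nonzero residues `-h, …, h` to `1, …, 2h`. -/
def resid (h : ℕ) (x : ℤ) : ℕ := if 0 < x then x.toNat else (x + (2 * h + 1)).toNat

theorem nat_partition (h t : ℕ) (r : Fin t → ℕ) (hr : ∀ i, 2 ≤ r i) (hsum : ∑ i, r i = 2 * h) :
    ∃ R : Fin t → Finset ℕ,
      (∀ i j, i ≠ j → Disjoint (R i) (R j)) ∧
      (∀ i, R i ⊆ Finset.Icc 1 (2 * h)) ∧
      (∀ i, (R i).card = r i) ∧
      (∀ i, (2 * h + 1) ∣ ∑ x ∈ R i, x) := by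
  classical
  obtain ⟨R, h1, h2, h3, h4⟩ := int_partition h t r hr hsum
  have hinj : ∀ i j, ∀ x ∈ R i, ∀ z ∈ R j, resid h x = resid h z → x = z := by
    intro i j x hx z hz hxz
    have a := h2 i x hx
    have b := h2 j z hz
    unfold resid at hxz
    split_ifs at hxz <;> omega
  refine ⟨fun i => (R i).image (resid h), ?_, ?_, ?_, ?_⟩
  · intro i j hij
    rw [Finset.disjoint_left]
    intro w hw hw'
    obtain ⟨x, hx, rfl⟩ := Finset.mem_image.1 hw
    obtain ⟨z, hz, hzx⟩ := Finset.mem_image.1 hw'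
    have := hinj j i z hz x hx hzx
    subst this
    exact Finset.disjoint_left.1 (h1 i j hij) hx hz
  · intro i w hw
    obtain ⟨x, hx, rfl⟩ := Finset.mem_image.1 hw
    have a := h2 i x hx
    rw [Finset.mem_Icc]
    unfold resid
    split_ifs <;> omega
  · intro i
    rw [← h3 i]
    exact Finset.card_image_of_injOn fun x hx z hz hxz => hinj i i x hx z hz hxz
  · intro i
    rw [Finset.sum_image fun x hx z hz hxz => hinj i i x hx z hz hxz]
    have key : ((2 * h + 1 : ℕ) : ℤ) ∣ ∑ x ∈ R i, ((resid h x : ℤ) - x) := by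
      refine Finset.dvd_sum fun x hx => ?_
      have a := h2 i x hx
      unfold resid
      split_ifs with hp
      · exact ⟨0, by omega⟩
      · exact ⟨1, by omega⟩
    rw [Finset.sum_sub_distrib, h4 i, sub_zero] at key
    exact_mod_cast key

theorem cover_of_card (n t : ℕ) (r : Fin t → ℕ) (hsum : ∑ i, r i = n) (R : Fin t → Finset ℕ)
    (hd : ∀ i j, i ≠ j → Disjoint (R i) (R j)) (hs : ∀ i, R i ⊆ Finset.Icc 1 n)
    (hc : ∀ i, (R i).card = r i) : Finset.univ.biUnion R = Finset.Icc 1 n := by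
  refine Finset.eq_of_subset_of_card_le (Finset.biUnion_subset.2 fun i _ => hs i) ?_
  rw [Finset.card_biUnion fun i _ j _ hij => hd i j hij, Finset.sum_congr rfl fun i _ => hc i,
    hsum, Nat.card_Icc]
  omega


/-- Lemma 2.2 (partition lemma): for `n ≥ 2` partitioned as `n = r 0 + ⋯ + r (t-1)` with each
`r i ≥ 2`, the set `{1, …, n}` can be partitioned into sets `R i` of size `r i` whose element
sums are all divisible by `n+1` if `n` is even and by `n` if `n` is odd. -/
theorem partition_lemma (n t : ℕ) (hn : 2 ≤ n) (ht : 1 ≤ t)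
    (r : Fin t → ℕ) (hr : ∀ i, 2 ≤ r i) (hsum : ∑ i, r i = n) :
    ∃ R : Fin t → Finset ℕ,
      (∀ i j, i ≠ j → Disjoint (R i) (R j)) ∧
      (Finset.univ.biUnion R = Finset.Icc 1 n) ∧
      (∀ i, (R i).card = r i) ∧
      (∀ i, (if Even n then n + 1 else n) ∣ ∑ x ∈ R i, x) := by
  by_cases hev : Even n
  · simp only [hev, if_true]
    obtain ⟨h, hh⟩ := hev
    obtain rfl : n = 2 * h := by omega
    obtain ⟨R, h1, h2, h3, h4⟩ := nat_partition h t r hr hsum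
    exact ⟨R, h1, cover_of_card _ t r hsum R h1 h2 h3, h3, h4⟩
  · simp only [hev, if_false]
    obtain ⟨h, rfl⟩ := Nat.not_even_iff_odd.1 hev
    obtain ⟨i₀, hi₀⟩ : ∃ i, Odd (r i) := by
      by_contra hcon
      push Not at hcon
      apply hev
      rw [← hsum]
      exact Finset.even_sum _ fun i _ => Nat.not_odd_iff_even.1 (hcon i)
    let r' : Fin t → ℕ := fun i => if i = i₀ then r i - 1 else r i
    have hrr : ∀ i, r i = r' i + if i = i₀ then 1 else 0 := by
      intro i
      have := hr i
      simp only [r']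
      split_ifs <;> omega
    have hr' : ∀ i, 2 ≤ r' i := by
      intro i
      have := hr i
      obtain ⟨m, hm⟩ := hi₀
      have := hr i₀
      simp only [r']
      split_ifs with hi
      · subst hi; omega
      · omega
    have hs' : ∑ i, r' i = 2 * h := by
      have h0 := hsum
      rw [Finset.sum_congr rfl fun i _ => hrr i, Finset.sum_add_distrib] at h0
      simp only [Finset.sum_ite_eq', Finset.mem_univ, if_true] at h0
      omega
    obtain ⟨R, h1, h2, h3, h4⟩ := nat_partition h t r' hr' hs'
    have hnot : ∀ i, 2 * h + 1 ∉ R i := by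
      intro i hi
      have := Finset.mem_Icc.1 (h2 i hi)
      omega
    let S : Fin t → Finset ℕ := fun i => if i = i₀ then insert (2 * h + 1) (R i) else R i
    have hS1 : ∀ i j, i ≠ j → Disjoint (S i) (S j) := by
      intro i j hij
      have hd := h1 i j hij
      simp only [S]
      split_ifs with hi hj hj
      · exact absurd (hi.trans hj.symm) hij
      · exact Finset.disjoint_insert_left.2 ⟨hnot j, hd⟩
      · exact Finset.disjoint_insert_right.2 ⟨hnot i, hd⟩
      · exact hd
    have hS2 : ∀ i, S i ⊆ Finset.Icc 1 (2 * h + 1) := by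
      intro i x hx
      have hx' : x = 2 * h + 1 ∨ x ∈ R i := by
        simp only [S] at hx
        split_ifs at hx
        · exact Finset.mem_insert.1 hx
        · exact Or.inr hx
      rw [Finset.mem_Icc]
      rcases hx' with hx' | hx'
      · omega
      · have := Finset.mem_Icc.1 (h2 i hx')
        omega
    have hS3 : ∀ i, (S i).card = r i := by
      intro i
      rw [hrr i, ← h3 i]
      simp only [S]
      split_ifs
      · exact Finset.card_insert_of_notMem (hnot i)
      · rfl
    refine ⟨S, hS1, cover_of_card _ t r hsum S hS1 hS2 hS3, hS3, ?_⟩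
    intro i
    simp only [S]
    split_ifs
    · rw [Finset.sum_insert (hnot i)]
      exact dvd_add dvd_rfl (h4 i)
    · exact h4 i
end

section
/- Every bipartite graph with no vertex of degree 0 and no vertex of degree 2 admits an antimagic orientation. -/
variable {V : Type*} [Fintype V] [DecidableEq V]

/-- `A` is an orientation of the simple graph `G`: the arcs of `A` are exactly the edges of
`G`, each edge receiving exactly one of its two possible directions. -/
def IsOrientation (G : SimpleGraph V) (A : Finset (V × V)) : Prop :=
  (∀ a ∈ A, G.Adj a.1 a.2) ∧
  (∀ u v : V, G.Adj u v → ((u, v) ∈ A ∨ (v, u) ∈ A)) ∧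
  (∀ u v : V, (u, v) ∈ A → (v, u) ∉ A)

/-- The oriented vertex sum at `v`: the sum of labels of arcs entering `v` minus the sum of
labels of arcs leaving `v`. -/
def orientedSum (A : Finset (V × V)) (σ : V × V → ℤ) (v : V) : ℤ :=
  (∑ a ∈ A.filter (fun a => a.2 = v), σ a) - (∑ a ∈ A.filter (fun a => a.1 = v), σ a)

/-- `G` admits an antimagic orientation: some orientation `A` of `G` has a bijective labeling
of its arcs by `{1, …, m}` (with `m` the number of edges of `G`) whose oriented vertex sums
are pairwise distinct. -/
def HasAntimagicOrientation (G : SimpleGraph V) [DecidableRel G.Adj] : Prop :=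
  ∃ A : Finset (V × V), IsOrientation G A ∧
    ∃ σ : V × V → ℤ, Set.InjOn σ A ∧
      A.image σ = Finset.Icc 1 (G.edgeFinset.card : ℤ) ∧
      ∀ u v : V, u ≠ v → orientedSum A σ u ≠ orientedSum A σ v

theorem exists_indep_matching (G : SimpleGraph V) (hbip : G.Colorable 2) :
    ∃ A : Finset V, (∀ a ∈ A, ∀ b ∈ A, ¬ G.Adj a b) ∧
      ∃ f : V → V, (∀ b, b ∉ A → f b ∈ A ∧ G.Adj (f b) b) ∧
        ∀ b b', b ∉ A → b' ∉ A → f b = f b' → b = b' := by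
  classical
  obtain ⟨C⟩ := hbip
  obtain ⟨A, hA, hmax⟩ := Finset.exists_max_image
    ((Finset.univ : Finset (Finset V)).filter (fun A => ∀ a ∈ A, ∀ b ∈ A, ¬ G.Adj a b))
    Finset.card ⟨∅, by simp⟩
  simp only [Finset.mem_filter, Finset.mem_univ, true_and] at hA hmax
  refine ⟨A, hA, ?_⟩
  have key : ∀ (c : Fin 2) (S : Finset V), (∀ x ∈ S, C x = c ∧ x ∉ A) →
      S.card ≤ (A.filter (fun a => ∃ b ∈ S, G.Adj b a)).card := by
    intro c S hS
    have h1 := hmax ((A \ A.filter (fun a => ∃ b ∈ S, G.Adj b a)) ∪ S) (by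
      intro a ha b hb hab
      simp only [Finset.mem_union, Finset.mem_sdiff, Finset.mem_filter, not_and, not_exists] at ha hb
      rcases ha with ⟨ha1, ha2⟩ | ha
      · rcases hb with ⟨hb1, hb2⟩ | hb
        · exact hA a ha1 b hb1 hab
        · exact ha2 ha1 b hb hab.symm
      · rcases hb with ⟨hb1, hb2⟩ | hb
        · exact hb2 hb1 a ha hab
        · exact C.valid hab ((hS a ha).1.trans (hS b hb).1.symm))
    rw [Finset.card_union_of_disjoint, Finset.card_sdiff_of_subset (Finset.filter_subset _ _)] at h1
    · have := Finset.card_le_card (Finset.filter_subset (fun a => ∃ b ∈ S, G.Adj b a) A)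
      omega
    · rw [Finset.disjoint_left]
      intro x hx hxS
      exact (hS x hxS).2 (Finset.mem_sdiff.1 hx).1
  have hall := (Finset.all_card_le_biUnion_card_iff_exists_injective
    (fun b : {b // b ∉ A} => A.filter (fun a => G.Adj b.1 a))).1 (by
      intro s
      have h0 := key 0 ((s.map (Function.Embedding.subtype _)).filter (fun x => C x = 0)) (by
        intro x hx
        simp only [Finset.mem_filter, Finset.mem_map, Function.Embedding.subtype_apply] at hx
        obtain ⟨⟨y, hy, rfl⟩, h⟩ := hx
        exact ⟨h, y.2⟩)
      have h1 := key 1 ((s.map (Function.Embedding.subtype _)).filter (fun x => ¬ C x = 0)) (by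
        intro x hx
        simp only [Finset.mem_filter, Finset.mem_map, Function.Embedding.subtype_apply] at hx
        obtain ⟨⟨y, hy, rfl⟩, h⟩ := hx
        exact ⟨by omega, y.2⟩)
      have h2 := Finset.card_filter_add_card_filter_not (s := s.map (Function.Embedding.subtype _))
        (fun x => C x = 0)
      rw [Finset.card_map] at h2
      rw [← h2]
      refine (Nat.add_le_add h0 h1).trans ?_
      rw [← Finset.card_union_of_disjoint]
      · apply Finset.card_le_card
        intro a ha
        simp only [Finset.mem_union, Finset.mem_filter, Finset.mem_map,
          Function.Embedding.subtype_apply, Finset.mem_biUnion] at ha ⊢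
        rcases ha with ⟨ha, b, ⟨⟨y, hy, rfl⟩, -⟩, hb⟩ | ⟨ha, b, ⟨⟨y, hy, rfl⟩, -⟩, hb⟩
        · exact ⟨y, hy, ha, hb⟩
        · exact ⟨y, hy, ha, hb⟩
      · rw [Finset.disjoint_left]
        intro a ha ha'
        simp only [Finset.mem_filter] at ha ha'
        obtain ⟨-, b, ⟨-, hb⟩, hab⟩ := ha
        obtain ⟨-, b', ⟨-, hb'⟩, hab'⟩ := ha'
        have := C.valid hab
        have := C.valid hab'
        omega)
  obtain ⟨f, hf, hf2⟩ := hall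
  refine ⟨fun b => if h : b ∉ A then f ⟨b, h⟩ else b, ?_, ?_⟩
  · intro b hb
    have := hf2 ⟨b, hb⟩
    simp only [Finset.mem_filter] at this
    simp only [hb, not_false_eq_true, dif_pos]
    exact ⟨this.1, this.2.symm⟩
  · intro b b' hb hb' h
    simp only [hb, hb', not_false_eq_true, dif_pos] at h
    simpa using hf h

theorem sort_lemma {ι : Type*} [DecidableEq ι] (n : ℕ) : ∀ (B : Finset ι) (S : Finset ℤ) (w : ι → ℤ),
    B.card = n → S.card = n →
    ∃ t : ι → ℤ, Set.InjOn t B ∧ B.image t = S ∧ Set.InjOn (fun b => w b + t b) B := by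
  induction n with
  | zero =>
    intro B S w hB hS
    rw [Finset.card_eq_zero] at hB hS
    subst hB hS
    exact ⟨fun _ => 0, by simp, by simp, by simp⟩
  | succ n ih =>
    intro B S w hB hS
    obtain ⟨b, hb, hbm⟩ := Finset.exists_max_image B w (Finset.card_pos.1 (by omega))
    obtain ⟨s, hs, hsm⟩ := Finset.exists_max_image S id (Finset.card_pos.1 (by omega))
    obtain ⟨t, h1, h2, h3⟩ := ih (B.erase b) (S.erase s) w
      (by rw [Finset.card_erase_of_mem hb]; omega) (by rw [Finset.card_erase_of_mem hs]; omega)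
    have ht : ∀ x ∈ B, x ≠ b → t x < s := by
      intro x hx hxb
      have : t x ∈ S.erase s := by
        rw [← h2]; exact Finset.mem_image_of_mem _ (Finset.mem_erase.2 ⟨hxb, hx⟩)
      rw [Finset.mem_erase] at this
      exact lt_of_le_of_ne (hsm _ this.2) this.1
    refine ⟨fun x => if x = b then s else t x, ?_, ?_, ?_⟩
    · intro x hx y hy hxy
      simp only at hxy
      split_ifs at hxy with h h' h'
      · rw [h, h']
      · have := ht y hy h'; omega
      · have := ht x hx h; omega
      · exact h1 (by simpa [h] using hx) (by simpa [h'] using hy) hxy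
    · conv_lhs => rw [← Finset.insert_erase hb]
      rw [Finset.image_insert, if_pos rfl, ← Finset.insert_erase hs, ← h2]
      congr 1
      apply Finset.image_congr
      intro x hx
      have : x ≠ b := (Finset.mem_erase.1 (Finset.mem_coe.1 hx)).1
      simp [this]
    · intro x hx y hy hxy
      simp only at hxy
      split_ifs at hxy with h h' h'
      · rw [h, h']
      · have := ht y hy h'; have := hbm y hy; subst h; omega
      · have := ht x hx h; have := hbm x hx; subst h'; omega
      · exact h3 (by simpa [h] using hx) (by simpa [h'] using hy) hxy

theorem split_lemma (y : ℕ) : ∀ (x : ℕ) (R : Finset ℤ), R.card = x + y →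
    ∃ L S : Finset ℤ, L.card = x ∧ S.card = y ∧ L ∪ S = R ∧ ∀ l ∈ L, ∀ s ∈ S, l < s := by
  induction y with
  | zero => intro x R h; exact ⟨R, ∅, by omega, by simp, by simp, by simp⟩
  | succ y ih =>
    intro x R h
    obtain ⟨s, hs, hsm⟩ := Finset.exists_max_image R id (Finset.card_pos.1 (by omega))
    obtain ⟨L, S, h1, h2, h3, h4⟩ := ih x (R.erase s) (by rw [Finset.card_erase_of_mem hs]; omega)
    have hsS : s ∉ S := fun h => by
      have : s ∈ R.erase s := by rw [← h3]; exact Finset.mem_union_right _ h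
      simp at this
    refine ⟨L, insert s S, h1, by rw [Finset.card_insert_of_notMem hsS, h2], ?_, ?_⟩
    · rw [Finset.union_insert, h3, Finset.insert_erase hs]
    · intro l hl t ht
      rw [Finset.mem_insert] at ht
      rcases ht with rfl | ht
      · have : l ∈ R.erase t := by rw [← h3]; exact Finset.mem_union_left _ hl
        rw [Finset.mem_erase] at this
        exact lt_of_le_of_ne (hsm _ this.2) this.1
      · exact h4 l hl t ht

theorem triple_lemma (q : ℕ) : ∃ T : ℕ → ℕ → ℤ,
    (∀ i < q, T i 0 + T i 1 + T i 2 = 0) ∧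
    (∀ i < q, ∀ k < 3, T i k ≠ 0 ∧ |T i k| ≤ 2 * q + (if q = 1 then 1 else 0)) ∧
    (∀ i < q, ∀ j < q, ∀ k < 3, ∀ l < 3, T i k = T j l → i = j ∧ k = l) := by
  have base : ∀ r : ℕ, ∃ T : ℕ → ℕ → ℤ,
    (∀ i < 2 * r, T i 0 + T i 1 + T i 2 = 0) ∧
    (∀ i < 2 * r, ∀ k < 3, T i k ≠ 0 ∧ |T i k| ≤ 4 * r - 1 ∧ (2 ≤ r → |T i k| ≠ 2)) ∧
    (∀ i < 2 * r, ∀ j < 2 * r, ∀ k < 3, ∀ l < 3, T i k = T j l → i = j ∧ k = l) := by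
    intro r
    refine ⟨fun i k => (if i % 2 = 0 then 1 else -1) *
      (if k = 0 then 2 * ((i / 2 : ℕ) : ℤ) + 1 else if k = 1 then 3 * (r : ℤ) - 1 - (i / 2 : ℕ)
        else -(3 * (r : ℤ) + (i / 2 : ℕ))), ?_, ?_, ?_⟩
    · intro i hi
      simp only [if_true, one_ne_zero, if_false, OfNat.ofNat_ne_zero, OfNat.ofNat_ne_one]
      ring
    · intro i hi k hk
      have h0 : i / 2 < r := by omega
      have e1 : i % 2 = 0 ∨ i % 2 = 1 := by omega
      dsimp only
      clear hi
      generalize i / 2 = a at *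
      rcases e1 with e1 | e1 <;> interval_cases k <;> simp only [e1, if_true, one_ne_zero, if_false,
          OfNat.ofNat_ne_zero, OfNat.ofNat_ne_one] <;>
        (refine ⟨by omega, ?_, ?_⟩ <;> first | (rw [abs_le]; omega) | (intro _; rw [ne_eq, abs_eq (by norm_num)]; omega))
    · intro i hi j hj k hk l hl h
      have h0 : i / 2 < r := by omega
      have h1 : j / 2 < r := by omega
      have hi2 : i = 2 * (i / 2) + i % 2 := by omega
      have hj2 : j = 2 * (j / 2) + j % 2 := by omega
      have e1 : i % 2 = 0 ∨ i % 2 = 1 := by omega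
      have e2 : j % 2 = 0 ∨ j % 2 = 1 := by omega
      generalize i / 2 = a at *
      generalize j / 2 = b at *
      rcases e1 with e1 | e1 <;> rcases e2 with e2 | e2 <;> interval_cases k <;> interval_cases l <;>
        simp [e1, e2] at h <;> omega
  obtain ⟨r, rfl | rfl⟩ := Nat.even_or_odd' q
  · obtain ⟨T, h1, h2, h3⟩ := base r
    refine ⟨T, h1, ?_, h3⟩
    intro i hi k hk
    obtain ⟨a, b, -⟩ := h2 i hi k hk
    refine ⟨a, ?_⟩
    rw [if_neg (by omega)]
    push_cast
    omega
  · rcases Nat.lt_or_ge r 2 with hr | hr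
    · interval_cases r
      · refine ⟨fun i k => if k = 0 then 1 else if k = 1 then 2 else -3, ?_, ?_, ?_⟩
        · intro i hi; simp
        · intro i hi k hk
          interval_cases k <;> simp
        · intro i hi j hj k hk l hl h
          refine ⟨by omega, ?_⟩
          interval_cases k <;> interval_cases l <;> simp at h ⊢
      · refine ⟨fun i k => if i = 0 then (if k = 0 then 1 else if k = 1 then 3 else -4)
          else if i = 1 then (if k = 0 then -1 else if k = 1 then 6 else -5)
          else (if k = 0 then 2 else if k = 1 then 4 else -6), ?_, ?_, ?_⟩
        · intro i hi; interval_cases i <;> simp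
        · intro i hi k hk
          interval_cases i <;> interval_cases k <;> simp
        · intro i hi j hj k hk l hl h
          interval_cases i <;> interval_cases j <;> interval_cases k <;> interval_cases l <;> simp at h ⊢
    · obtain ⟨T, h1, h2, h3⟩ := base r
      have hx : ∀ k < 3, ∀ i < 2 * r, ∀ l < 3,
          T i l ≠ (if k = 0 then 2 else if k = 1 then 4 * (r : ℤ) else -(4 * (r : ℤ) + 2)) := by
        intro k hk i hi l hl h
        obtain ⟨-, b, c⟩ := h2 i hi l hl
        have c := c hr
        rw [h] at b c
        interval_cases k
        · simp at c
        · simp only [one_ne_zero, if_false, if_true, abs_le] at b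
          omega
        · simp only [OfNat.ofNat_ne_zero, OfNat.ofNat_ne_one, if_false, abs_le] at b
          omega
      refine ⟨fun i k => if i < 2 * r then T i k else
        (if k = 0 then 2 else if k = 1 then 4 * (r : ℤ) else -(4 * (r : ℤ) + 2)), ?_, ?_, ?_⟩
      · intro i hi
        by_cases h : i < 2 * r
        · simp only [h, if_true]; exact h1 i h
        · simp only [h, if_true, if_false, one_ne_zero, OfNat.ofNat_ne_zero, OfNat.ofNat_ne_one]; ring
      · intro i hi k hk
        rw [if_neg (by omega : ¬ (2 * r + 1 = 1))]
        by_cases h : i < 2 * r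
        · simp only [h, if_true]
          obtain ⟨a, b, -⟩ := h2 i h k hk
          refine ⟨a, ?_⟩
          push_cast
          omega
        · simp only [h, if_false]
          refine ⟨by split_ifs <;> omega, ?_⟩
          rw [abs_le]
          push_cast
          split_ifs <;> constructor <;> omega
      · intro i hi j hj k hk l hl h
        by_cases hi' : i < 2 * r <;> by_cases hj' : j < 2 * r <;> simp only [hi', hj', if_true, if_false] at h
        · exact h3 i hi' j hj' k hk l hl h
        · exact absurd h (hx l hl i hi' k hk)
        · exact absurd h.symm (hx k hk j hj' l hl)
        · refine ⟨by omega, ?_⟩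
          interval_cases k <;> interval_cases l <;> simp only [if_true, if_false, one_ne_zero,
            OfNat.ofNat_ne_zero, OfNat.ofNat_ne_one] at h ⊢ <;> omega

theorem exists_idx {α : Type*} [DecidableEq α] (s : Finset α) : ∃ idx : α → ℕ, Set.InjOn idx s ∧
    s.image idx = Finset.range s.card := by
  have key : ∃ idx : α → ℕ, Set.InjOn idx s ∧ ∀ x ∈ s, idx x < s.card := by
    refine ⟨fun x => if h : x ∈ s then (s.equivFin ⟨x, h⟩ : ℕ) else 0, ?_, ?_⟩
    · intro x hx y hy hxy
      rw [Finset.mem_coe] at hx hy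
      simp only [hx, hy, dif_pos] at hxy
      simpa using s.equivFin.injective (Fin.ext hxy)
    · intro x hx
      simp only [hx, dif_pos]
      exact (s.equivFin ⟨x, hx⟩).2
  obtain ⟨idx, h1, h2⟩ := key
  refine ⟨idx, h1, ?_⟩
  apply Finset.eq_of_subset_of_card_le
  · intro k hk
    obtain ⟨x, hx, rfl⟩ := Finset.mem_image.1 hk
    exact Finset.mem_range.2 (h2 x hx)
  · rw [Finset.card_range, Finset.card_image_of_injOn h1]

theorem group_lemma {ι κ : Type*} [DecidableEq ι] [Fintype κ] [DecidableEq κ] (g : ι → κ) (n : ℕ) :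
    ∀ F : Finset ι, F.card = n → (∀ a, (F.filter (fun e => g e = a)).card ≠ 1) →
    ∃ z : ι → ℤ, ∃ N : ℕ, Set.InjOn z F ∧ (∀ e ∈ F, z e ≠ 0 ∧ |z e| ≤ N) ∧
      (∀ a, ∑ e ∈ F.filter (fun e => g e = a), z e = 0) ∧
      2 * N = F.card + (Finset.univ.filter (fun a => (F.filter (fun e => g e = a)).card % 2 = 1)).card +
        (if (Finset.univ.filter (fun a => (F.filter (fun e => g e = a)).card % 2 = 1)).card = 1
          then 2 else 0) := by
  induction n using Nat.strong_induction_on with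
  | _ n ih =>
  intro F hF h1
  by_cases hc : ∃ a, 2 ≤ (F.filter (fun e => g e = a)).card ∧ (F.filter (fun e => g e = a)).card ≠ 3
  · obtain ⟨a, ha, ha3⟩ := hc
    obtain ⟨x, hx, y, hy, hxy⟩ := Finset.one_lt_card.1 (show 1 < _ from ha)
    rw [Finset.mem_filter] at hx hy
    set F' := (F.erase x).erase y with hF'
    have hxF' : x ∉ F' := by simp [hF']
    have hyF' : y ∉ F' := by simp [hF']
    have hFF : F = insert x (insert y F') := by
      rw [hF', Finset.insert_erase, Finset.insert_erase hx.1]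
      simp [hy.1, hxy.symm]
    have hfa : F.filter (fun e => g e = a) = insert x (insert y (F'.filter (fun e => g e = a))) := by
      conv_lhs => rw [hFF]
      rw [Finset.filter_insert, if_pos hx.2, Finset.filter_insert, if_pos hy.2]
    have hfb : ∀ b, b ≠ a → F.filter (fun e => g e = b) = F'.filter (fun e => g e = b) := by
      intro b hb
      conv_lhs => rw [hFF]
      rw [Finset.filter_insert, if_neg (by rw [hx.2]; exact hb.symm), Finset.filter_insert,
        if_neg (by rw [hy.2]; exact hb.symm)]
    have hca : (F.filter (fun e => g e = a)).card = (F'.filter (fun e => g e = a)).card + 2 := by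
      rw [hfa, Finset.card_insert_of_notMem (by simp [hxy, hxF']),
        Finset.card_insert_of_notMem (by simp [hyF'])]
    have hcF : F.card = F'.card + 2 := by
      rw [hFF, Finset.card_insert_of_notMem (by simp [hxy, hxF']),
        Finset.card_insert_of_notMem (by simp [hyF'])]
    have hpar : ∀ b, (F.filter (fun e => g e = b)).card % 2 = 1 ↔
        (F'.filter (fun e => g e = b)).card % 2 = 1 := by
      intro b
      by_cases hb : b = a
      · subst hb; omega
      · rw [hfb b hb]
    obtain ⟨z, N, z1, z2, z3, z4⟩ := ih F'.card (by omega) F' rfl (by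
      intro b
      by_cases hb : b = a
      · subst hb; omega
      · rw [← hfb b hb]; exact h1 b)
    simp only [hpar]
    have hlt : ∀ e ∈ F', z e < N + 1 ∧ -(N + 1 : ℤ) < z e := by
      intro e he
      have := abs_le.1 (z2 e he).2
      omega
    have hne : ∀ e ∈ F', e ≠ x ∧ e ≠ y := by
      intro e he
      exact ⟨fun h => hxF' (h ▸ he), fun h => hyF' (h ▸ he)⟩
    refine ⟨fun e => if e = x then (N + 1 : ℤ) else if e = y then -(N + 1 : ℤ) else z e, N + 1, ?_, ?_, ?_, ?_⟩
    · intro e he e' he' hee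
      rw [Finset.mem_coe, hFF, Finset.mem_insert, Finset.mem_insert] at he he'
      rcases he with rfl | rfl | he <;> rcases he' with rfl | rfl | he'
      · rfl
      · simp [hxy.symm] at hee; omega
      · have := hlt e' he'
        simp [hne e' he'] at hee; omega
      · simp [hxy.symm] at hee; omega
      · rfl
      · have := hlt e' he'
        simp [hne e' he', hxy.symm] at hee; omega
      · have := hlt e he
        simp [hne e he] at hee; omega
      · have := hlt e he
        simp [hne e he, hxy.symm] at hee; omega
      · simp [hne e he, hne e' he'] at hee
        exact z1 he he' hee
    · intro e he
      rw [hFF, Finset.mem_insert, Finset.mem_insert] at he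
      rcases he with rfl | rfl | he
      · simp only [if_true]
        refine ⟨by omega, ?_⟩
        rw [abs_le]; push_cast; omega
      · simp only [if_true, hxy.symm, if_false]
        refine ⟨by omega, ?_⟩
        rw [abs_le]; push_cast; omega
      · simp only [hne e he, if_false]
        refine ⟨(z2 e he).1, ?_⟩
        have := hlt e he
        rw [abs_le]; push_cast; omega
    · have hs : ∀ b, ∑ e ∈ F'.filter (fun e => g e = b),
          (if e = x then (N + 1 : ℤ) else if e = y then -(N + 1 : ℤ) else z e) = 0 := by
        intro b
        rw [← z3 b]
        apply Finset.sum_congr rfl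
        intro e he
        have := hne e (Finset.mem_filter.1 he).1
        simp [this]
      intro b
      by_cases hb : b = a
      · subst hb
        rw [hfa, Finset.sum_insert (by simp [hxy, hxF']), Finset.sum_insert (by simp [hyF']), hs]
        simp [hxy.symm]
      · rw [hfb b hb, hs]
    · omega
  · push Not at hc
    have h03 : ∀ a, (F.filter (fun e => g e = a)).card = 0 ∨ (F.filter (fun e => g e = a)).card = 3 := by
      intro a
      have := h1 a
      have := hc a
      omega
    set Q := Finset.univ.filter (fun a => (F.filter (fun e => g e = a)).card % 2 = 1) with hQ
    have hQ3 : ∀ a ∈ Q, (F.filter (fun e => g e = a)).card = 3 := by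
      intro a ha
      rw [hQ, Finset.mem_filter] at ha
      rcases h03 a with h | h <;> omega
    have hFQ : ∀ e ∈ F, g e ∈ Q := by
      intro e he
      rw [hQ, Finset.mem_filter]
      refine ⟨Finset.mem_univ _, ?_⟩
      rcases h03 (g e) with h | h
      · rw [Finset.card_eq_zero] at h
        have : e ∈ F.filter (fun e' => g e' = g e) := Finset.mem_filter.2 ⟨he, rfl⟩
        rw [h] at this
        simp at this
      · omega
    have hcard : F.card = 3 * Q.card := by
      rw [Finset.card_eq_sum_card_fiberwise (f := g) (t := Q) (fun e he => hFQ e he),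
        Finset.sum_congr rfl hQ3, Finset.sum_const, smul_eq_mul, mul_comm]
    obtain ⟨idx, i1, i2⟩ := exists_idx Q
    choose pos p1 p2 using fun a => exists_idx (F.filter (fun e => g e = a))
    obtain ⟨T, T1, T2, T3⟩ := triple_lemma Q.card
    have hidx : ∀ a ∈ Q, idx a < Q.card := by
      intro a ha
      rw [← Finset.mem_range, ← i2]
      exact Finset.mem_image_of_mem _ ha
    have hpos : ∀ e ∈ F, pos (g e) e < 3 := by
      intro e he
      rw [← hQ3 _ (hFQ e he), ← Finset.mem_range, ← p2]
      exact Finset.mem_image_of_mem _ (Finset.mem_filter.2 ⟨he, rfl⟩)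
    refine ⟨fun e => T (idx (g e)) (pos (g e) e), 2 * Q.card + (if Q.card = 1 then 1 else 0), ?_, ?_, ?_, ?_⟩
    · intro e he e' he' h
      obtain ⟨h2, h3⟩ := T3 _ (hidx _ (hFQ e he)) _ (hidx _ (hFQ e' he')) _ (hpos e he) _ (hpos e' he') h
      have h4 := i1 (hFQ e he) (hFQ e' he') h2
      rw [← h4] at h3
      exact p1 (g e) (by simpa using he) (by simpa [h4] using he') h3
    · intro e he
      have := T2 _ (hidx _ (hFQ e he)) _ (hpos e he)
      push_cast
      exact this
    · intro a
      rcases h03 a with h | h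
      · rw [Finset.card_eq_zero] at h
        rw [h, Finset.sum_empty]
      · have haQ : a ∈ Q := by rw [hQ, Finset.mem_filter]; exact ⟨Finset.mem_univ _, by omega⟩
        have : ∑ e ∈ F.filter (fun e => g e = a), T (idx (g e)) (pos (g e) e) =
            ∑ k ∈ (F.filter (fun e => g e = a)).image (pos a), T (idx a) k := by
          rw [Finset.sum_image (p1 a)]
          apply Finset.sum_congr rfl
          intro e he
          rw [(Finset.mem_filter.1 he).2]
        rw [this, p2, h, Finset.sum_range_succ, Finset.sum_range_succ, Finset.sum_range_one]
        exact T1 _ (hidx a haQ)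
    · split_ifs <;> omega

theorem orientedSum_insert (D : Finset (V × V)) (σ : V × V → ℤ) (p : V × V) (hp : p ∉ D) (v : V) :
    orientedSum (insert p D) σ v = orientedSum D σ v + (if p.2 = v then σ p else 0) -
      (if p.1 = v then σ p else 0) := by
  unfold orientedSum
  rw [Finset.filter_insert, Finset.filter_insert]
  split_ifs <;> (try rw [Finset.sum_insert (by simp [hp])]) <;> (try rw [Finset.sum_insert (by simp [hp])]) <;> ring

theorem orientedSum_congr (D : Finset (V × V)) (σ τ : V × V → ℤ) (h : ∀ p ∈ D, σ p = τ p) (v : V) :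
    orientedSum D σ v = orientedSum D τ v := by
  unfold orientedSum
  congr 1 <;> exact Finset.sum_congr rfl (fun p hp => h p (Finset.mem_filter.1 hp).1)

theorem orientedSum_union (D E : Finset (V × V)) (h : Disjoint D E) (σ : V × V → ℤ) (v : V) :
    orientedSum (D ∪ E) σ v = orientedSum D σ v + orientedSum E σ v := by
  unfold orientedSum
  rw [Finset.filter_union, Finset.filter_union, Finset.sum_union (Finset.disjoint_filter_filter h),
    Finset.sum_union (Finset.disjoint_filter_filter h)]
  ring

theorem inside_lemma (n : ℕ) : ∀ (E : Finset (V × V)) (L : Finset ℤ) (M : ℤ) (u : V),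
    E.card = n → L.card = n → (∀ p ∈ E, p.swap ∉ E) → 0 ≤ M → (∀ l ∈ L, 0 ≤ l ∧ l ≤ M) →
    ∃ (D : Finset (V × V)) (σ : V × V → ℤ), D.card = n ∧
      (∀ p, (p ∈ D ∨ p.swap ∈ D) ↔ (p ∈ E ∨ p.swap ∈ E)) ∧ (∀ p ∈ D, p.swap ∉ D) ∧
      Set.InjOn σ D ∧ D.image σ = L ∧ (∀ v, -M ≤ orientedSum D σ v) ∧ 0 ≤ orientedSum D σ u := by
  induction n with
  | zero =>
    intro E L M u hE hL _ hM _
    rw [Finset.card_eq_zero] at hE hL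
    subst hE hL
    exact ⟨∅, fun _ => 0, by simp, by simp, by simp, by simp, by simp, fun _ => by simpa [orientedSum] using hM,
      by simp [orientedSum]⟩
  | succ n ih =>
    have main : ∀ (E : Finset (V × V)) (L : Finset ℤ) (M : ℤ) (u : V),
      E.card = n + 1 → L.card = n + 1 → (∀ p ∈ E, p.swap ∉ E) → 0 ≤ M → (∀ l ∈ L, 0 ≤ l ∧ l ≤ M) →
      (∃ w, (w, u) ∈ E ∨ (u, w) ∈ E) →
      ∃ (D : Finset (V × V)) (σ : V × V → ℤ), D.card = n + 1 ∧
      (∀ p, (p ∈ D ∨ p.swap ∈ D) ↔ (p ∈ E ∨ p.swap ∈ E)) ∧ (∀ p ∈ D, p.swap ∉ D) ∧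
      Set.InjOn σ D ∧ D.image σ = L ∧ (∀ v, -M ≤ orientedSum D σ v) ∧ 0 ≤ orientedSum D σ u := by
      intro E L M u hE hL hEs hM hLM ⟨w, hw⟩
      obtain ⟨l, hl, hlm⟩ := Finset.exists_max_image L id (Finset.card_pos.1 (by omega))
      simp only [id] at hlm
      have hwu : w ≠ u := by
        rintro rfl
        have := hEs (w, w)
        simp only [Prod.swap_prod_mk] at this
        tauto
      obtain ⟨p, hp, hpw⟩ : ∃ p ∈ E, p = (w, u) ∨ p = (u, w) := by
        rcases hw with h | h
        · exact ⟨_, h, Or.inl rfl⟩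
        · exact ⟨_, h, Or.inr rfl⟩
      have hl0 := hLM l hl
      obtain ⟨D, σ, d1, d2, d3, d4, d5, d6, d7⟩ := ih (E.erase p) (L.erase l) l w
        (by rw [Finset.card_erase_of_mem hp]; omega) (by rw [Finset.card_erase_of_mem hl]; omega)
        (fun x hx hx' => hEs x (Finset.mem_of_mem_erase hx) (Finset.mem_of_mem_erase hx')) hl0.1
        (fun x hx => ⟨(hLM x (Finset.mem_of_mem_erase hx)).1, hlm x (Finset.mem_of_mem_erase hx)⟩)
      have hnp : p ∉ D ∧ p.swap ∉ D := by
        rw [← not_or, d2]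
        rintro (h | h)
        · simp at h
        · exact hEs p hp (Finset.mem_of_mem_erase h)
      have hn1 : (w, u) ∉ D := by rcases hpw with rfl | rfl; exacts [hnp.1, hnp.2]
      have hn2 : (u, w) ∉ D := by rcases hpw with rfl | rfl; exacts [hnp.2, hnp.1]
      have hcong : ∀ x ∈ D, (if x = (w, u) then l else σ x) = σ x := by
        intro x hx
        rw [if_neg]
        rintro rfl
        exact hn1 hx
      have hσl : ∀ x ∈ D, σ x ≠ l := by
        intro x hx h
        have : σ x ∈ L.erase l := by rw [← d5]; exact Finset.mem_image_of_mem _ hx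
        simp [h] at this
      have hsum : ∀ v, orientedSum (insert (w, u) D) (fun x => if x = (w, u) then l else σ x) v =
          orientedSum D σ v + (if u = v then l else 0) - (if w = v then l else 0) := by
        intro v
        rw [orientedSum_insert _ _ _ hn1, orientedSum_congr D _ σ hcong]
        simp
      refine ⟨insert (w, u) D, fun x => if x = (w, u) then l else σ x, ?_, ?_, ?_, ?_, ?_, ?_, ?_⟩
      · rw [Finset.card_insert_of_notMem hn1, d1]
      · intro x
        have := d2 x
        simp only [Finset.mem_insert, Finset.mem_erase, ne_eq] at this ⊢
        have e1 : x.swap = (w, u) ↔ x = (u, w) := by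
          rw [← Prod.swap_inj]; simp
        have e2 : x.swap = (u, w) ↔ x = (w, u) := by
          rw [← Prod.swap_inj]; simp
        rcases hpw with rfl | rfl
        · rw [e1] at this ⊢
          by_cases hx1 : x = (w, u)
          · subst hx1; simp [hp]
          · by_cases hx2 : x = (u, w)
            · subst hx2; simp [hp]
            · simpa [hx1, hx2, e1, e2] using this
        · rw [e2] at this
          rw [e1]
          by_cases hx1 : x = (w, u)
          · subst hx1; simp [hp]
          · by_cases hx2 : x = (u, w)
            · subst hx2; simp [hp]
            · simpa [hx1, hx2, e1, e2] using this
      · intro x hx hx'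
        rw [Finset.mem_insert] at hx hx'
        rcases hx with rfl | hx
        · rcases hx' with h | h
          · simp [hwu.symm] at h
          · exact hn2 h
        · rcases hx' with h | h
          · have : x = (u, w) := by rw [← Prod.swap_inj, h]; rfl
            exact hn2 (this ▸ hx)
          · exact d3 x hx h
      · intro x hx y hy hxy
        rw [Finset.mem_coe, Finset.mem_insert] at hx hy
        dsimp only at hxy
        rcases hx with rfl | hx <;> rcases hy with rfl | hy
        · rfl
        · rw [hcong y hy, if_pos rfl] at hxy
          exact absurd hxy.symm (hσl y hy)
        · rw [hcong x hx, if_pos rfl] at hxy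
          exact absurd hxy (hσl x hx)
        · rw [hcong x hx, hcong y hy] at hxy
          exact d4 hx hy hxy
      · rw [Finset.image_insert, if_pos rfl, Finset.image_congr (g := σ) (fun x hx => hcong x hx), d5,
          Finset.insert_erase hl]
      · intro v
        rw [hsum]
        have := d6 v
        by_cases h1 : u = v
        · rw [if_pos h1, if_neg (by rw [← h1]; exact hwu)]; omega
        · by_cases h2 : w = v
          · subst h2
            rw [if_neg h1, if_pos rfl]; omega
          · rw [if_neg h1, if_neg h2]; omega
      · rw [hsum, if_pos rfl, if_neg hwu]
        have := d6 u
        omega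
    intro E L M u hE hL hEs hM hLM
    by_cases hu : ∃ w, (w, u) ∈ E ∨ (u, w) ∈ E
    · exact main E L M u hE hL hEs hM hLM hu
    · obtain ⟨p, hp⟩ := Finset.card_pos.1 (show 0 < E.card by omega)
      obtain ⟨D, σ, d1, d2, d3, d4, d5, d6, d7⟩ := main E L M p.1 hE hL hEs hM hLM ⟨p.2, Or.inr hp⟩
      refine ⟨D, σ, d1, d2, d3, d4, d5, d6, ?_⟩
      push Not at hu
      have hD : ∀ x ∈ D, x.1 ≠ u ∧ x.2 ≠ u := by
        intro x hx
        have := (d2 x).1 (Or.inl hx)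
        obtain ⟨x1, x2⟩ := x
        simp only [Prod.swap_prod_mk] at this
        constructor
        · rintro rfl
          have := hu x2
          tauto
        · rintro rfl
          have := hu x1
          tauto
      unfold orientedSum
      rw [Finset.filter_false_of_mem (fun x hx => (hD x hx).2),
        Finset.filter_false_of_mem (fun x hx => (hD x hx).1)]
      simp

theorem orientation_card (G : SimpleGraph V) [DecidableRel G.Adj] (A : Finset (V × V))
    (h : IsOrientation G A) : A.card = G.edgeFinset.card := by
  obtain ⟨h1, h2, h3⟩ := h
  apply Finset.card_bij (fun p _ => s(p.1, p.2))
  · intro p hp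
    simpa using h1 p hp
  · rintro ⟨a, b⟩ hp ⟨c, d⟩ hq h
    simp only [Sym2.eq_iff] at h
    rcases h with ⟨rfl, rfl⟩ | ⟨rfl, rfl⟩
    · rfl
    · exact absurd hq (h3 _ _ hp)
  · intro e he
    induction e with
    | _ u v =>
    rw [SimpleGraph.mem_edgeFinset, SimpleGraph.mem_edgeSet] at he
    rcases h2 u v he with h | h
    · exact ⟨(u, v), h, rfl⟩
    · exact ⟨(v, u), h, Sym2.eq_swap⟩

/-- Theorem 1.3: every bipartite graph with no vertex of degree 0 and no vertex of degree 2
admits an antimagic orientation. -/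
theorem bipartite_no_deg_zero_two_antimagic_orientation
    (G : SimpleGraph V) [DecidableRel G.Adj] (hbip : G.Colorable 2)
    (hdeg : ∀ v : V, G.degree v ≠ 0 ∧ G.degree v ≠ 2) :
    HasAntimagicOrientation G := by
  obtain ⟨A, hA, f, hf, hfi⟩ := exists_indep_matching G hbip
  obtain ⟨C⟩ := hbip
  rcases isEmpty_or_nonempty V with hV | ⟨⟨u0⟩⟩
  · have h0 : IsOrientation G ∅ := ⟨by simp, fun u => hV.elim u, by simp⟩
    refine ⟨∅, h0, fun _ => 0, by simp, ?_, fun u => hV.elim u⟩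
    rw [← orientation_card G ∅ h0]
    simp
  obtain ⟨B, hB⟩ : ∃ B : Finset V, ∀ b, b ∈ B ↔ b ∉ A := ⟨Aᶜ, by simp⟩
  obtain ⟨E1, hE1⟩ : ∃ E : Finset (V × V), ∀ p, p ∈ E ↔ p.1 ∈ A ∧ G.Adj p.1 p.2 :=
    ⟨Finset.univ.filter (fun p : V × V => p.1 ∈ A ∧ G.Adj p.1 p.2), by simp⟩
  obtain ⟨E2, hE2⟩ : ∃ E : Finset (V × V), ∀ p, p ∈ E ↔
      p.1 ∉ A ∧ p.2 ∉ A ∧ G.Adj p.1 p.2 ∧ C p.1 = 0 :=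
    ⟨Finset.univ.filter (fun p : V × V => p.1 ∉ A ∧ p.2 ∉ A ∧ G.Adj p.1 p.2 ∧ C p.1 = 0), by simp⟩
  have hE2s : ∀ p ∈ E2, p.swap ∉ E2 := by
    intro p hp hp'
    rw [hE2] at hp hp'
    exact C.valid hp.2.2.1 (hp.2.2.2.trans hp'.2.2.2.symm)
  have hE1snd : ∀ p ∈ E1, p.2 ∉ A := by
    intro p hp h
    rw [hE1] at hp
    exact hA _ hp.1 _ h hp.2
  -- special edges
  have hs : ∀ a, ∃ c, G.Adj a c ∧ ∀ b, b ∉ A → f b = a → c = b := by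
    intro a
    by_cases h : ∃ b, b ∉ A ∧ f b = a
    · obtain ⟨b, hb, rfl⟩ := h
      exact ⟨b, (hf b hb).2, fun b' hb' h => hfi b b' hb hb' h.symm⟩
    · have := (hdeg a).1
      rw [← SimpleGraph.card_neighborFinset_eq_degree, Finset.card_ne_zero] at this
      obtain ⟨c, hc⟩ := this
      exact ⟨c, by simpa using hc, fun b hb h' => absurd ⟨b, hb, h'⟩ h⟩
  choose s hs1 hs2 using hs
  have hsf : ∀ b ∈ B, s (f b) = b := fun b hb => hs2 (f b) b ((hB b).1 hb) rfl
  have hfA : ∀ b ∈ B, f b ∈ A := fun b hb => (hf b ((hB b).1 hb)).1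
  have hfinj : Set.InjOn f B := by
    intro b hb b' hb' h
    exact hfi b b' ((hB b).1 hb) ((hB b').1 hb') h
  have hBA : B.card ≤ A.card := Finset.card_le_card_of_injOn f hfA hfinj
  obtain ⟨F, hF⟩ : ∃ F : Finset (V × V), ∀ p, p ∈ F ↔ p ∈ E1 ∧ p.2 ≠ s p.1 :=
    ⟨E1.filter (fun p => p.2 ≠ s p.1), by simp⟩
  have hinjs : Function.Injective (fun a => (a, s a)) := fun a b h => (Prod.ext_iff.1 h).1
  obtain ⟨Sp, hSp⟩ : ∃ S : Finset (V × V), S = A.image (fun a => (a, s a)) := ⟨_, rfl⟩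
  have hSpm : ∀ p, p ∈ Sp ↔ p.1 ∈ A ∧ p.2 = s p.1 := by
    intro p
    rw [hSp, Finset.mem_image]
    constructor
    · rintro ⟨a, ha, rfl⟩
      exact ⟨ha, rfl⟩
    · rintro ⟨h1, h2⟩
      exact ⟨p.1, h1, by rw [← h2]⟩
  have hSpc : Sp.card = A.card := by rw [hSp, Finset.card_image_of_injective _ hinjs]
  have hdisj1 : Disjoint F Sp := by
    rw [Finset.disjoint_left]
    intro p hp hp'
    rw [hF] at hp
    rw [hSpm] at hp'
    exact hp.2 hp'.2
  have hE1u : E1 = F ∪ Sp := by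
    ext p
    rw [Finset.mem_union, hF, hSpm]
    constructor
    · intro h
      by_cases h' : p.2 = s p.1
      · exact Or.inr ⟨((hE1 p).1 h).1, h'⟩
      · exact Or.inl ⟨h, h'⟩
    · rintro (h | h)
      · exact h.1
      · rw [hE1, h.2]
        exact ⟨h.1, hs1 _⟩
  have hE1c : E1.card = F.card + A.card := by
    rw [hE1u, Finset.card_union_of_disjoint hdisj1, hSpc]
  have hfib0 : ∀ a, a ∉ A → (F.filter (fun p => p.1 = a)) = ∅ := by
    intro a ha
    apply Finset.filter_false_of_mem
    rintro p hp rfl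
    rw [hF, hE1] at hp
    exact ha hp.1.1
  have hfib : ∀ a ∈ A, (F.filter (fun p => p.1 = a)).card = G.degree a - 1 := by
    intro a ha
    have : F.filter (fun p => p.1 = a) = ((G.neighborFinset a).erase (s a)).image (fun c => (a, c)) := by
      ext ⟨x, y⟩
      simp only [Finset.mem_filter, hF, hE1, Finset.mem_image, Finset.mem_erase,
        SimpleGraph.mem_neighborFinset, Prod.mk.injEq]
      constructor
      · rintro ⟨⟨⟨h1, h2⟩, h3⟩, rfl⟩
        exact ⟨y, ⟨h3, h2⟩, rfl, rfl⟩
      · rintro ⟨c, ⟨h1, h2⟩, rfl, rfl⟩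
        exact ⟨⟨⟨ha, h2⟩, h1⟩, rfl⟩
    rw [this, Finset.card_image_of_injective _ (fun c d h => (Prod.ext_iff.1 h).2),
      Finset.card_erase_of_mem (by simpa using hs1 a), SimpleGraph.card_neighborFinset_eq_degree]
  obtain ⟨z, N, z1, z2, z3, z4⟩ := group_lemma (Prod.fst : V × V → V) F.card F rfl (by
    intro a
    by_cases ha : a ∈ A
    · rw [hfib a ha]
      have := hdeg a
      omega
    · rw [hfib0 a ha]; simp)
  have hqA : (Finset.univ.filter (fun a => (F.filter (fun e => e.1 = a)).card % 2 = 1)) ⊆ A := by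
    intro a ha
    by_contra h
    rw [Finset.mem_filter, hfib0 a h] at ha
    simp at ha
  have hN : 2 * N ≤ F.card + A.card := by
    have hqc := Finset.card_le_card hqA
    rw [z4]
    split_ifs with hq
    · obtain ⟨a, ha⟩ := Finset.card_pos.1 (show 0 < _ by rw [hq]; norm_num)
      have haA := hqA ha
      rw [Finset.mem_filter, hfib a haA] at ha
      have hd := hdeg a
      have : G.degree a ≤ B.card := by
        rw [← SimpleGraph.card_neighborFinset_eq_degree]
        apply Finset.card_le_card
        intro b hb
        rw [hB]
        intro hbA
        exact hA a haA b hbA (by simpa using hb)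
      omega
    · omega
  obtain ⟨m, hm⟩ : ∃ m, m = E1.card + E2.card := ⟨_, rfl⟩
  obtain ⟨σF, hσF⟩ : ∃ g : V × V → ℤ, ∀ p, g p = if 0 < z p then z p else m + 1 + z p := ⟨_, fun _ => rfl⟩
  have hz : ∀ p ∈ F, z p ≠ 0 ∧ -(N : ℤ) ≤ z p ∧ z p ≤ N := fun p hp =>
    ⟨(z2 p hp).1, abs_le.1 (z2 p hp).2⟩
  have hFr : ∀ p ∈ F, 1 ≤ σF p ∧ σF p ≤ m := by
    intro p hp
    have := hz p hp
    rw [hσF]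
    split_ifs <;> omega
  have hFi : Set.InjOn σF F := by
    intro p hp p' hp' h
    have h1 := hz p hp
    have h2 := hz p' hp'
    rw [hσF, hσF] at h
    apply z1 hp hp'
    split_ifs at h <;> omega
  have hFmod : ∀ p, (m + 1 : ℤ) ∣ σF p - z p := by
    intro p
    rw [hσF]
    split_ifs
    · simp
    · exact ⟨1, by ring⟩
  have hFsub : F.image σF ⊆ Finset.Icc (1 : ℤ) m := by
    intro x hx
    obtain ⟨p, hp, rfl⟩ := Finset.mem_image.1 hx
    exact Finset.mem_Icc.2 (hFr p hp)
  have hRc : (Finset.Icc (1 : ℤ) m \ F.image σF).card = (E2.card + (A.card - B.card)) + B.card := by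
    rw [Finset.card_sdiff_of_subset hFsub, Finset.card_image_of_injOn hFi, Int.card_Icc]
    omega
  obtain ⟨L', S, l1, l2, l3, l4⟩ := split_lemma B.card _ _ hRc
  obtain ⟨L, U, k1, k2, k3, k4⟩ := split_lemma (A.card - B.card) _ _ l1
  have hRr : ∀ x, x ∈ L ∨ x ∈ U ∨ x ∈ S → 1 ≤ x ∧ x ≤ m := by
    intro x hx
    have : x ∈ Finset.Icc (1 : ℤ) m \ F.image σF := by
      rw [← l3, ← k3, Finset.mem_union, Finset.mem_union]
      tauto
    exact Finset.mem_Icc.1 (Finset.mem_sdiff.1 this).1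
  obtain ⟨M, hM0, hML, hMS⟩ : ∃ M : ℤ, 0 ≤ M ∧ (∀ l ∈ L, l ≤ M) ∧ ∀ x ∈ S, M < x := by
    rcases L.eq_empty_or_nonempty with hL | hL
    · exact ⟨0, le_rfl, by simp [hL], fun x hx => (hRr x (by tauto)).1⟩
    · obtain ⟨l, hl, hlm⟩ := Finset.exists_max_image L id hL
      refine ⟨l, by have := hRr l (by tauto); omega, hlm, fun x hx => l4 l ?_ x hx⟩
      rw [← k3]
      exact Finset.mem_union_left _ hl
  obtain ⟨D, τ, d1, d2, d3, d4, d5, d6, -⟩ := inside_lemma E2.card E2 L M u0 rfl k1 hE2s hM0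
    (fun l hl => ⟨by have := hRr l (by tauto); omega, hML l hl⟩)
  have hDA : ∀ p ∈ D, p.1 ∉ A ∧ p.2 ∉ A ∧ G.Adj p.1 p.2 := by
    intro p hp
    rcases (d2 p).1 (Or.inl hp) with h | h
    · rw [hE2] at h
      exact ⟨h.1, h.2.1, h.2.2.1⟩
    · rw [hE2] at h
      exact ⟨h.2.1, h.1, h.2.2.1.symm⟩
  -- labels of the special edges
  obtain ⟨A0, hA0⟩ : ∃ A0 : Finset V, A0 = A \ B.image f := ⟨_, rfl⟩
  have hBfA : B.image f ⊆ A := by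
    intro a ha
    obtain ⟨b, hb, rfl⟩ := Finset.mem_image.1 ha
    exact hfA b hb
  have hA0c : A0.card = A.card - B.card := by
    rw [hA0, Finset.card_sdiff_of_subset hBfA, Finset.card_image_of_injOn hfinj]
  have hA0f : ∀ b ∈ B, f b ∉ A0 := by
    intro b hb h
    rw [hA0, Finset.mem_sdiff] at h
    exact h.2 (Finset.mem_image_of_mem _ hb)
  have hA0A : ∀ a ∈ A0, a ∈ A := by
    intro a ha
    rw [hA0, Finset.mem_sdiff] at ha
    exact ha.1
  have hAcase : ∀ a ∈ A, a ∈ A0 ∨ ∃ b ∈ B, f b = a := by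
    intro a ha
    by_cases h : a ∈ B.image f
    · exact Or.inr (Finset.mem_image.1 h)
    · left; rw [hA0, Finset.mem_sdiff]; exact ⟨ha, h⟩
  obtain ⟨t0, -, t02, -⟩ := sort_lemma (A.card - B.card) A0 U (fun _ => 0) hA0c k2
  obtain ⟨w, hw⟩ : ∃ w : V → ℤ, ∀ b, w b = ∑ p ∈ F.filter (fun p => p.2 = b), σF p +
    ∑ a ∈ A0.filter (fun a => s a = b), t0 a + orientedSum D τ b := ⟨_, fun _ => rfl⟩
  obtain ⟨t, t1, t2, t3⟩ := sort_lemma B.card B S w rfl l2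
  obtain ⟨ts, hts⟩ : ∃ ts : V → ℤ, ∀ a, ts a = if a ∈ A0 then t0 a else t (s a) := ⟨_, fun _ => rfl⟩
  have hts0 : ∀ a ∈ A0, ts a = t0 a := fun a ha => by rw [hts, if_pos ha]
  have htsf : ∀ b ∈ B, ts (f b) = t b := fun b hb => by rw [hts, if_neg (hA0f b hb), hsf b hb]
  have ht0U : ∀ a ∈ A0, t0 a ∈ U := fun a ha => by rw [← t02]; exact Finset.mem_image_of_mem _ ha
  have htS : ∀ b ∈ B, t b ∈ S := fun b hb => by rw [← t2]; exact Finset.mem_image_of_mem _ hb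
  have htsim : A.image ts = U ∪ S := by
    ext x
    rw [Finset.mem_image, Finset.mem_union]
    constructor
    · rintro ⟨a, ha, rfl⟩
      rcases hAcase a ha with h | ⟨b, hb, rfl⟩
      · left; rw [hts0 a h]; exact ht0U a h
      · right; rw [htsf b hb]; exact htS b hb
    · rintro (h | h)
      · rw [← t02] at h
        obtain ⟨a, ha, rfl⟩ := Finset.mem_image.1 h
        exact ⟨a, hA0A a ha, hts0 a ha⟩
      · rw [← t2] at h
        obtain ⟨b, hb, rfl⟩ := Finset.mem_image.1 h
        exact ⟨f b, hfA b hb, htsf b hb⟩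
  have htsr : ∀ a ∈ A, 1 ≤ ts a ∧ ts a ≤ m := by
    intro a ha
    have : ts a ∈ U ∪ S := by rw [← htsim]; exact Finset.mem_image_of_mem _ ha
    rw [Finset.mem_union] at this
    exact hRr _ (Or.inr this)
  have htsi : Set.InjOn ts A := by
    rw [← Finset.card_image_iff, htsim, Finset.card_union_of_disjoint, k2, l2]
    · omega
    · rw [Finset.disjoint_left]
      intro x hx hx'
      have := l4 x (by rw [← k3]; exact Finset.mem_union_right _ hx) x hx'
      omega
  -- the orientation and the labelling
  have hdisj2 : Disjoint (F ∪ Sp) D := by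
    rw [← hE1u, Finset.disjoint_left]
    intro p hp hp'
    exact (hDA p hp').1 ((hE1 p).1 hp).1
  have hO : IsOrientation G ((F ∪ Sp) ∪ D) := by
    rw [← hE1u]
    refine ⟨?_, ?_, ?_⟩
    · intro p hp
      rw [Finset.mem_union] at hp
      rcases hp with hp | hp
      · exact ((hE1 p).1 hp).2
      · exact (hDA p hp).2.2
    · intro u v huv
      simp only [Finset.mem_union]
      by_cases hu : u ∈ A
      · exact Or.inl (Or.inl ((hE1 _).2 ⟨hu, huv⟩))
      · by_cases hv : v ∈ A
        · exact Or.inr (Or.inl ((hE1 _).2 ⟨hv, huv.symm⟩))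
        · have : (u, v) ∈ D ∨ (u, v).swap ∈ D := by
            rw [d2]
            have hc := C.valid huv
            by_cases h0 : C u = 0
            · left; rw [hE2]; exact ⟨hu, hv, huv, h0⟩
            · right; rw [hE2]; exact ⟨hv, hu, huv.symm, by simp only [Prod.swap_prod_mk]; omega⟩
          rw [Prod.swap_prod_mk] at this
          tauto
    · intro u v h h'
      rw [Finset.mem_union] at h h'
      rcases h with h | h <;> rcases h' with h' | h'
      · exact hE1snd _ h ((hE1 _).1 h').1
      · exact (hDA _ h').2.1 ((hE1 _).1 h).1
      · exact (hDA _ h).2.1 ((hE1 _).1 h').1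
      · exact d3 _ h h'
  obtain ⟨σ, hσ⟩ : ∃ σ : V × V → ℤ, ∀ p, σ p = if p ∈ F then σF p else if p ∈ D then τ p else ts p.1 :=
    ⟨_, fun _ => rfl⟩
  have hσ1 : ∀ p ∈ F, σ p = σF p := fun p hp => by rw [hσ, if_pos hp]
  have hσ2 : ∀ p ∈ D, σ p = τ p := fun p hp => by
    rw [hσ, if_neg, if_pos hp]
    intro h
    exact Finset.disjoint_left.1 hdisj2 (Finset.mem_union_left _ h) hp
  have hσ3 : ∀ p ∈ Sp, σ p = ts p.1 := fun p hp => by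
    rw [hσ, if_neg (Finset.disjoint_right.1 hdisj1 hp),
      if_neg (Finset.disjoint_left.1 hdisj2 (Finset.mem_union_right _ hp))]
  have hOc : ((F ∪ Sp) ∪ D).card = m := by
    rw [Finset.card_union_of_disjoint hdisj2, ← hE1u, d1, hm]
  have himg : ((F ∪ Sp) ∪ D).image σ = Finset.Icc (1 : ℤ) m := by
    have e1 : F.image σ = F.image σF := Finset.image_congr (fun p hp => hσ1 p hp)
    have e2 : D.image σ = L := by rw [← d5]; exact Finset.image_congr (fun p hp => hσ2 p hp)
    have e3 : Sp.image σ = U ∪ S := by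
      rw [← htsim, Finset.image_congr (g := fun p : V × V => ts p.1) (fun p hp => hσ3 p hp), hSp,
        Finset.image_image]
      rfl
    rw [Finset.image_union, Finset.image_union, e1, e2, e3]
    have e4 : F.image σF ∪ (U ∪ S) ∪ L = F.image σF ∪ ((L ∪ U) ∪ S) := by
      ext x; simp only [Finset.mem_union]; tauto
    rw [e4, k3, l3, Finset.union_sdiff_of_subset hFsub]
  have hsplit : ∀ v, orientedSum ((F ∪ Sp) ∪ D) σ v =
      orientedSum F σF v + orientedSum Sp (fun p => ts p.1) v + orientedSum D τ v := by
    intro v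
    rw [orientedSum_union _ _ hdisj2, orientedSum_union _ _ hdisj1, orientedSum_congr F _ _ hσ1,
      orientedSum_congr Sp _ _ hσ3, orientedSum_congr D _ _ hσ2]
  have hFsnd : ∀ p ∈ F, p.1 ∈ A ∧ p.2 ∉ A := fun p hp =>
    ⟨((hE1 p).1 ((hF p).1 hp).1).1, hE1snd p ((hF p).1 hp).1⟩
  have hSsnd : ∀ p ∈ Sp, p.1 ∈ A ∧ p.2 ∉ A := fun p hp =>
    ⟨((hSpm p).1 hp).1, hE1snd p (by rw [hE1u]; exact Finset.mem_union_right _ hp)⟩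
  have hsumA : ∀ a ∈ A, orientedSum ((F ∪ Sp) ∪ D) σ a =
      -(∑ p ∈ F.filter (fun p => p.1 = a), σF p + ts a) := by
    intro a ha
    rw [hsplit]
    unfold orientedSum
    have g1 : F.filter (fun p => p.2 = a) = ∅ := Finset.filter_false_of_mem
      (fun p hp h => (hFsnd p hp).2 (h ▸ ha))
    have g2 : Sp.filter (fun p => p.2 = a) = ∅ := Finset.filter_false_of_mem
      (fun p hp h => (hSsnd p hp).2 (h ▸ ha))
    have g3 : D.filter (fun p => p.2 = a) = ∅ := Finset.filter_false_of_mem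
      (fun p hp h => (hDA p hp).2.1 (h ▸ ha))
    have g4 : D.filter (fun p => p.1 = a) = ∅ := Finset.filter_false_of_mem
      (fun p hp h => (hDA p hp).1 (h ▸ ha))
    have g5 : Sp.filter (fun p => p.1 = a) = {(a, s a)} := by
      ext ⟨x, y⟩
      simp only [Finset.mem_filter, hSpm, Finset.mem_singleton, Prod.mk.injEq]
      constructor
      · rintro ⟨⟨-, rfl⟩, rfl⟩
        exact ⟨rfl, rfl⟩
      · rintro ⟨rfl, rfl⟩
        exact ⟨⟨ha, rfl⟩, rfl⟩
    rw [g1, g2, g3, g4, g5]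
    simp
    ring
  have hsumB : ∀ b ∈ B, orientedSum ((F ∪ Sp) ∪ D) σ b = w b + t b := by
    intro b hb
    have hbA := (hB b).1 hb
    rw [hsplit, hw]
    have g1 : F.filter (fun p => p.1 = b) = ∅ := Finset.filter_false_of_mem
      (fun p hp h => hbA (h ▸ (hFsnd p hp).1))
    have g2 : Sp.filter (fun p => p.1 = b) = ∅ := Finset.filter_false_of_mem
      (fun p hp h => hbA (h ▸ (hSsnd p hp).1))
    have g3 : Sp.filter (fun p => p.2 = b) =
        (insert (f b) (A0.filter (fun a => s a = b))).image (fun a => (a, s a)) := by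
      ext ⟨x, y⟩
      simp only [Finset.mem_filter, hSpm, Finset.mem_image, Finset.mem_insert, Prod.mk.injEq]
      constructor
      · rintro ⟨⟨hx, rfl⟩, rfl⟩
        refine ⟨x, ?_, rfl, rfl⟩
        rcases hAcase x hx with h | ⟨b', hb', rfl⟩
        · exact Or.inr ⟨h, rfl⟩
        · left; rw [hsf b' hb']
      · rintro ⟨a, h, rfl, rfl⟩
        rcases h with rfl | ⟨h1, h2⟩
        · exact ⟨⟨hfA b hb, rfl⟩, hsf b hb⟩
        · exact ⟨⟨hA0A a h1, rfl⟩, h2⟩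
    have g4 : orientedSum Sp (fun p => ts p.1) b = t b + ∑ a ∈ A0.filter (fun a => s a = b), t0 a := by
      unfold orientedSum
      rw [g2, g3, Finset.sum_image (fun x _ y _ h => hinjs h), Finset.sum_insert
        (fun h => hA0f b hb (Finset.mem_filter.1 h).1), htsf b hb]
      rw [Finset.sum_congr rfl (fun a ha => hts0 a (Finset.mem_filter.1 ha).1)]
      simp
    have g5 : orientedSum F σF b = ∑ p ∈ F.filter (fun p => p.2 = b), σF p := by
      unfold orientedSum
      rw [g1]
      simp
    rw [g4, g5]
    ring
  have hnegA : ∀ a ∈ A, orientedSum ((F ∪ Sp) ∪ D) σ a < 0 := by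
    intro a ha
    rw [hsumA a ha]
    have h1 : 0 ≤ ∑ p ∈ F.filter (fun p => p.1 = a), σF p := Finset.sum_nonneg (fun p hp => by
      have := hFr p (Finset.mem_filter.1 hp).1
      omega)
    have := htsr a ha
    omega
  have hposB : ∀ b ∈ B, 0 < orientedSum ((F ∪ Sp) ∪ D) σ b := by
    intro b hb
    rw [hsumB b hb, hw]
    have h1 : 0 ≤ ∑ p ∈ F.filter (fun p => p.2 = b), σF p := Finset.sum_nonneg (fun p hp => by
      have := hFr p (Finset.mem_filter.1 hp).1
      omega)
    have h2 : 0 ≤ ∑ a ∈ A0.filter (fun a => s a = b), t0 a := Finset.sum_nonneg (fun a ha => by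
      have := hRr _ (Or.inr (Or.inl (ht0U a (Finset.mem_filter.1 ha).1)))
      omega)
    have := hMS _ (htS b hb)
    have := d6 b
    omega
  have hmodA : ∀ a ∈ A, (m + 1 : ℤ) ∣ orientedSum ((F ∪ Sp) ∪ D) σ a + ts a := by
    intro a ha
    have h1 : (m + 1 : ℤ) ∣ ∑ p ∈ F.filter (fun p => p.1 = a), (σF p - z p) :=
      Finset.dvd_sum (fun p _ => hFmod p)
    rw [Finset.sum_sub_distrib, z3 a, sub_zero] at h1
    rw [hsumA a ha]
    obtain ⟨k, hk⟩ := h1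
    exact ⟨-k, by linear_combination -hk⟩
  refine ⟨(F ∪ Sp) ∪ D, hO, σ, ?_, ?_, ?_⟩
  · rw [← Finset.card_image_iff, himg, hOc, Int.card_Icc]
    omega
  · rw [himg, ← orientation_card G _ hO, hOc]
  · intro u v huv h
    by_cases hu : u ∈ A <;> by_cases hv : v ∈ A
    · apply huv
      apply htsi hu hv
      have h1 := hmodA u hu
      have h2 := hmodA v hv
      rw [h] at h1
      have h3 := dvd_sub h1 h2
      have r1 := htsr u hu
      have r2 := htsr v hv
      have h4 : (m + 1 : ℤ) ∣ ts u - ts v := by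
        obtain ⟨k, hk⟩ := h3
        exact ⟨k, by linear_combination hk⟩
      have := Int.eq_zero_of_abs_lt_dvd h4 (by rw [abs_lt]; constructor <;> omega)
      omega
    · have := hnegA u hu
      have := hposB v ((hB v).2 hv)
      omega
    · have := hnegA v hv
      have := hposB u ((hB u).2 hu)
      omega
    · have hu' := (hB u).2 hu
      have hv' := (hB v).2 hv
      rw [hsumB u hu', hsumB v hv'] at h
      exact huv (t3 hu' hv' h)
end

section
/- Let p ≥ 0 and m ≥ 1 be integers, and let G[S,T] be a bipartite graph with m edges such that every vertex of T has even degree in G (hence m need not be assumed even; in fact m is even). Set δ_m = p+m if m ≡ 0 (mod 4) and δ_m = p+m+1 if m ≡ 2 (mod 4). Then there exist an orientation D of G and a bijection σ from the arcs of D to {p+1, ..., p+m−1} ∪ {δ_m} such that s(v) = −d_G(v) for every v ∈ T, and ⌊(d_G(v)−1)/2⌋ − δ_m ≤ s(v) ≤ ⌊(d_G(v)−1)/2⌋ + δ_m for every v ∈ S. -/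
variable {V : Type*} [Fintype V] [DecidableEq V]

/-- The smaller label of the `i`-th pair of labels. -/
def pairLab (p i : ℕ) : ℤ := (p : ℤ) + 1 + 2 * i - (i % 2 : ℕ)

/-- Contribution at `v` of a list of arcs, the arcs being numbered from `k`. -/
def arcSum {V : Type*} [DecidableEq V] (p : ℕ) (v : V) : ℕ → List (V × V) → ℤ
  | _, [] => 0
  | k, e :: L => (if e.2 = v then pairLab p k + 2 else 0) - (if e.1 = v then pairLab p k else 0)
      + arcSum p v (k + 1) L

/-- Degree of `v` in a list of arcs. -/
def arcDeg {V : Type*} [DecidableEq V] (v : V) : List (V × V) → ℤ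
  | [] => 0
  | e :: L => (if e.2 = v then 1 else 0) + (if e.1 = v then 1 else 0) + arcDeg v L

/-- `L` is a walk from `u` to `w`. -/
def ArcWalk {V : Type*} : V → V → List (V × V) → Prop
  | u, w, [] => u = w
  | u, w, e :: L => e.1 = u ∧ ArcWalk e.2 w L

section helpers
variable {V : Type*} [DecidableEq V]

theorem arcSum_append (p : ℕ) (v : V) (L M : List (V × V)) (k : ℕ) :
    arcSum p v k (L ++ M) = arcSum p v k L + arcSum p v (k + L.length) M := by
  induction L generalizing k with
  | nil => simp [arcSum]
  | cons e L ih =>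
    simp only [List.cons_append, arcSum, ih, List.length_cons]
    rw [show k + 1 + L.length = k + (L.length + 1) by ring]; ring

theorem arcDeg_append (v : V) (L M : List (V × V)) :
    arcDeg v (L ++ M) = arcDeg v L + arcDeg v M := by
  induction L with
  | nil => simp [arcDeg]
  | cons e L ih => simp only [List.cons_append, arcDeg, ih]; ring

theorem arc_untouched (p : ℕ) (v : V) (L : List (V × V)) (h : ∀ e ∈ L, e.1 ≠ v ∧ e.2 ≠ v) (k : ℕ) :
    arcSum p v k L = 0 ∧ arcDeg v L = 0 := by
  induction L generalizing k with
  | nil => simp [arcSum, arcDeg]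
  | cons e L ih =>
    have h1 := h e (by simp)
    have h2 := ih (fun e he => h e (by simp [he])) (k + 1)
    simp [arcSum, arcDeg, h1.1, h1.2, h2.1, h2.2]

theorem arcWalk_append {V : Type*} (u w x : V) (L M : List (V × V)) (h1 : ArcWalk u w L)
    (h2 : ArcWalk w x M) : ArcWalk u x (L ++ M) := by
  induction L generalizing u with
  | nil => simp only [ArcWalk] at h1; subst h1; exact h2
  | cons e L ih => exact ⟨h1.1, ih _ h1.2⟩

theorem walk_sum (p : ℕ) (v w : V) (L : List (V × V)) (e : V × V) (u : V) (k : ℕ)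
    (h : ArcWalk u w (e :: L)) :
    ∃ q t : ℤ, -t ≤ q ∧ q ≤ t ∧ 0 ≤ t ∧ t ≤ L.length ∧
      arcSum p v k (e :: L) = q - (if u = v then pairLab p k else 0)
        + (if w = v then pairLab p (k + L.length) + 2 else 0) ∧
      arcDeg v (e :: L) = 2 * t + (if u = v then 1 else 0) + (if w = v then 1 else 0) := by
  induction L generalizing e u k with
  | nil =>
    obtain ⟨h1, h2⟩ := h
    simp only [ArcWalk] at h2
    refine ⟨0, 0, by simp, by simp, le_rfl, by simp, ?_, ?_⟩
    · simp only [arcSum, h1, h2, List.length_nil, add_zero]; ring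
    · simp only [arcDeg, h1, h2]; ring
  | cons f L ih =>
    obtain ⟨h1, h2⟩ := h
    obtain ⟨q, t, a1, a2, a3, a4, a5, a6⟩ := ih f e.2 (k + 1) h2
    rw [arcSum, arcDeg, a5, a6, h1]
    rw [show k + 1 + L.length = k + (f :: L).length by simp; ring]
    by_cases hv : e.2 = v
    · refine ⟨q + (pairLab p k + 2 - pairLab p (k + 1)), t + 1, ?_, ?_, ?_, ?_, ?_, ?_⟩
      · simp only [pairLab]; omega
      · simp only [pairLab]; omega
      · omega
      · simp; omega
      · simp only [hv, if_true]; ring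
      · simp only [hv, if_true]; ring
    · refine ⟨q, t, a1, a2, a3, ?_, ?_, ?_⟩
      · simp; omega
      · simp only [hv, if_false]; ring
      · simp only [hv, if_false]; ring

/-- The invariant at a vertex `v`. -/
def ArcInv (p : ℕ) (v : V) (L : List (V × V)) : Prop :=
  ∃ q t : ℤ, -t ≤ q ∧ q ≤ t ∧ 0 ≤ t ∧ t ≤ L.length ∧
    ((arcSum p v 0 L = q ∧ arcDeg v L = 2 * t) ∨
     (∃ i < L.length, arcSum p v 0 L = q + (pairLab p i + 2) ∧ arcDeg v L = 2 * t + 1) ∨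
     (∃ i < L.length, arcSum p v 0 L = q - pairLab p i ∧ arcDeg v L = 2 * t + 1 ∧
        t + 1 + i ≤ L.length) ∨
     (∃ i j, i ≤ j ∧ j < L.length ∧ arcSum p v 0 L = q + (pairLab p j + 2) - pairLab p i ∧
        arcDeg v L = 2 * t + 2))

theorem arcInv_append (p : ℕ) (v u w : V) (L P : List (V × V)) (hP : P ≠ []) (hW : ArcWalk u w P)
    (hL : ArcInv p v L) (hu : ∀ e ∈ L, e.1 ≠ u ∧ e.2 ≠ u) (hw : ∀ e ∈ L, e.1 ≠ w ∧ e.2 ≠ w) :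
    ArcInv p v (L ++ P) := by
  obtain ⟨e, P, rfl⟩ := List.exists_cons_of_ne_nil hP
  obtain ⟨q, t, a1, a2, a3, a4, a5, a6⟩ := walk_sum p v w P e u (0 + L.length) hW
  unfold ArcInv
  rw [arcSum_append, arcDeg_append, a5, a6]
  simp only [List.length_append, List.length_cons, Nat.cast_add, Nat.cast_one]
  by_cases h1 : u = v
  · obtain ⟨z1, z2⟩ := arc_untouched p v L (h1 ▸ hu) 0
    rw [z1, z2]
    refine ⟨q, t, a1, a2, a3, by omega, ?_⟩
    by_cases h2 : w = v
    · right; right; right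
      refine ⟨0 + L.length, 0 + L.length + P.length, by omega, by omega, ?_, ?_⟩
      · simp only [h1, h2, if_true]; ring
      · simp only [h1, h2, if_true]; ring
    · right; right; left
      refine ⟨0 + L.length, by omega, ?_, ?_, ?_⟩
      · simp only [h1, h2, if_true, if_false]; ring
      · simp only [h1, h2, if_true, if_false]; ring
      · push_cast; omega
  · by_cases h2 : w = v
    · obtain ⟨z1, z2⟩ := arc_untouched p v L (h2 ▸ hw) 0
      rw [z1, z2]
      refine ⟨q, t, a1, a2, a3, by omega, ?_⟩
      right; left
      refine ⟨0 + L.length + P.length, by omega, ?_, ?_⟩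
      · simp only [h1, h2, if_true, if_false]; ring
      · simp only [h1, h2, if_true, if_false]; ring
    · simp only [h1, h2, if_false]
      obtain ⟨q', t', b1, b2, b3, b4, b5⟩ := hL
      refine ⟨q' + q, t' + t, by omega, by omega, by omega, by omega, ?_⟩
      rcases b5 with ⟨c1, c2⟩ | ⟨i, hi, c1, c2⟩ | ⟨i, hi, c1, c2, c3⟩ | ⟨i, j, hij, hj, c1, c2⟩
      · left; constructor <;> omega
      · right; left; exact ⟨i, by omega, by omega, by omega⟩
      · right; right; left; exact ⟨i, by omega, by omega, by omega, by omega⟩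
      · right; right; right; exact ⟨i, j, by omega, by omega, by omega, by omega⟩

theorem arcInv_bound (p : ℕ) (v : V) (L : List (V × V)) (h : ArcInv p v L) (δ : ℤ)
    (hn : 1 ≤ L.length) (hδ : δ = p + 2 * L.length + (L.length % 2 : ℕ)) :
    (arcDeg v L - 1) / 2 - δ ≤ arcSum p v 0 L ∧ arcSum p v 0 L ≤ (arcDeg v L - 1) / 2 + δ := by
  obtain ⟨q', t', b1, b2, b3, b4, b5⟩ := h
  simp only [pairLab] at b5
  rcases b5 with ⟨c1, c2⟩ | ⟨i, hi, c1, c2⟩ | ⟨i, hi, c1, c2, c3⟩ | ⟨i, j, hij, hj, c1, c2⟩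
  · omega
  · omega
  · omega
  · omega

theorem trail_decomp {E : Type*} [DecidableEq E] (en : E → Bool → V) (p : ℕ) (F : Finset E) :
    ∃ L : List (E × Bool), (L.map Prod.fst).Nodup ∧ (∀ e, e ∈ L.map Prod.fst ↔ e ∈ F) ∧
      ∀ v, ArcInv p v (L.map fun a => (en a.1 a.2, en a.1 (!a.2))) := by
  induction F using Finset.strongInduction with
  | H F ih =>
  rcases F.eq_empty_or_nonempty with rfl | hne
  · refine ⟨[], by simp, by simp, fun v => ⟨0, 0, by simp, by simp, by simp, by simp, ?_⟩⟩
    left; simp [arcSum, arcDeg]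
  set ar : E × Bool → V × V := fun a => (en a.1 a.2, en a.1 (!a.2)) with har
  let Q : ℕ → Prop := fun n => ∃ (P : List (E × Bool)) (u w : V), (P.map Prod.fst).Nodup ∧
    (∀ e ∈ P.map Prod.fst, e ∈ F) ∧ ArcWalk u w (P.map ar) ∧ P.length = n
  have hbd : ∀ n, Q n → n ≤ F.card := by
    rintro n ⟨P, u, w, h1, h2, h3, rfl⟩
    rw [← List.length_map (f := Prod.fst), ← List.toFinset_card_of_nodup h1]
    exact Finset.card_le_card (fun e he => h2 e (List.mem_toFinset.1 he))
  classical
  obtain ⟨e0, he0⟩ := hne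
  have hQ1 : Q 1 := ⟨[(e0, false)], en e0 false, en e0 true, by simp, by simpa using he0,
    by simp [ArcWalk, har], rfl⟩
  have hcard : 1 ≤ F.card := hbd 1 hQ1
  have hspec : Q (Nat.findGreatest Q F.card) := Nat.findGreatest_spec hcard hQ1
  have hmax : ∀ n, Q n → n ≤ Nat.findGreatest Q F.card := fun n hn =>
    Nat.le_findGreatest (hbd n hn) hn
  obtain ⟨P, u, w, h1, h2, h3, h4⟩ := hspec
  rw [← h4] at hmax
  have hPne : P ≠ [] := by
    have := hmax 1 hQ1
    rintro rfl
    simp at this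
  obtain ⟨L, l1, l2, l3⟩ := ih (F \ (P.map Prod.fst).toFinset) (by
    obtain ⟨a, P', rfl⟩ := List.exists_cons_of_ne_nil hPne
    refine Finset.sdiff_ssubset ?_ ⟨a.1, by simp⟩
    intro e he; exact h2 e (List.mem_toFinset.1 he))
  have l2' : ∀ a ∈ L, a.1 ∈ F ∧ a.1 ∉ P.map Prod.fst := by
    intro a ha
    have := (l2 a.1).1 (List.mem_map_of_mem ha)
    rwa [Finset.mem_sdiff, List.mem_toFinset] at this
  have front : ∀ e ∈ F, e ∉ P.map Prod.fst → ∀ b, en e b ≠ u := by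
    intro e he heP b hb
    have := hmax (P.length + 1) ⟨(e, !b) :: P, en e (!b), w, ?_, ?_, ?_, by simp⟩
    · omega
    · simpa using ⟨by simpa using heP, h1⟩
    · simp only [List.map_cons, List.mem_cons]; rintro e' (rfl | h); exacts [he, h2 _ h]
    · refine ⟨rfl, ?_⟩
      simpa [har, hb] using h3
  have back : ∀ e ∈ F, e ∉ P.map Prod.fst → ∀ b, en e b ≠ w := by
    intro e he heP b hb
    have := hmax (P.length + 1) ⟨P ++ [(e, b)], u, en e (!b), ?_, ?_, ?_, by simp⟩
    · omega
    · rw [List.map_append, List.nodup_append]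
      refine ⟨h1, by simp, ?_⟩
      intro a ha c hc hac
      simp only [List.map_cons, List.map_nil, List.mem_singleton] at hc
      subst hac; subst hc; exact heP ha
    · rw [List.map_append]
      intro e' he'
      rcases List.mem_append.1 he' with h | h
      · exact h2 _ h
      · simp only [List.map_cons, List.map_nil, List.mem_singleton] at h
        subst h; exact he
    · rw [List.map_append]
      refine arcWalk_append _ _ _ _ _ h3 ⟨hb, rfl⟩
  refine ⟨L ++ P, ?_, ?_, ?_⟩
  · rw [List.map_append, List.nodup_append]
    refine ⟨l1, h1, ?_⟩
    intro a ha c hc hac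
    subst hac
    obtain ⟨x, hx, rfl⟩ := List.mem_map.1 ha
    exact (l2' x hx).2 hc
  · intro e
    rw [List.map_append, List.mem_append, l2, Finset.mem_sdiff, List.mem_toFinset]
    constructor
    · rintro (h | h)
      exacts [h.1, h2 _ h]
    · intro h
      by_cases he : e ∈ P.map Prod.fst
      exacts [Or.inr he, Or.inl ⟨h, he⟩]
  · intro v
    rw [List.map_append]
    refine arcInv_append p v u w _ _ (by simpa using hPne) h3 (l3 v) ?_ ?_
    · intro e he
      obtain ⟨a, ha, rfl⟩ := List.mem_map.1 he
      have := l2' a ha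
      exact ⟨front _ this.1 this.2 _, front _ this.1 this.2 _⟩
    · intro e he
      obtain ⟨a, ha, rfl⟩ := List.mem_map.1 he
      have := l2' a ha
      exact ⟨back _ this.1 this.2 _, back _ this.1 this.2 _⟩

theorem arcSum_ofFn (p : ℕ) (v : V) (n : ℕ) (g : Fin n → V × V) (k : ℕ) :
    arcSum p v k (List.ofFn g) = ∑ j : Fin n, ((if (g j).2 = v then pairLab p (k + j) + 2 else 0)
      - (if (g j).1 = v then pairLab p (k + j) else 0)) := by
  induction n generalizing k with
  | zero => simp [arcSum]
  | succ n ih =>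
    rw [List.ofFn_succ, arcSum, ih, Fin.sum_univ_succ]
    simp [add_comm, add_left_comm]

theorem arcDeg_ofFn (v : V) (n : ℕ) (g : Fin n → V × V) :
    arcDeg v (List.ofFn g) = ∑ j : Fin n, ((if (g j).2 = v then 1 else 0)
      + (if (g j).1 = v then 1 else 0)) := by
  induction n with
  | zero => simp [arcDeg]
  | succ n ih => rw [List.ofFn_succ, arcDeg, ih, Fin.sum_univ_succ]

theorem exists_pairing [Fintype V] (G : SimpleGraph V) [DecidableRel G.Adj] (T : Set V)
    (hTeven : ∀ v ∈ T, Even (G.degree v)) (p : ℕ) :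
    ∃ (n : ℕ) (t : Fin n → V) (z : Fin n → Bool → V),
      (∀ j b, t j ∈ T ∧ G.Adj (t j) (z j b)) ∧
      (∀ j b j' b', t j = t j' → z j b = z j' b' → j = j' ∧ b = b') ∧
      (∀ u w, u ∈ T → G.Adj u w → ∃ j b, t j = u ∧ z j b = w) ∧
      ∀ v, ArcInv p v (List.ofFn fun j => (z j false, z j true)) := by
  classical
  let N : V → Finset V := fun t => if t ∈ T then G.neighborFinset t else ∅
  have hN : ∀ t x, x ∈ N t ↔ t ∈ T ∧ G.Adj t x := by
    intro t x; by_cases h : t ∈ T <;> simp [N, h]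
  have hev : ∀ t, ∃ k, Nonempty (Fin k × Bool ≃ N t) := by
    intro t
    have : Even (N t).card := by
      by_cases h : t ∈ T
      · simpa [N, h] using hTeven t h
      · simp [N, h]
    obtain ⟨k, hk⟩ := this
    refine ⟨k, ⟨Fintype.equivOfCardEq ?_⟩⟩
    simp; omega
  choose k hk using hev
  let f : ∀ t, Fin (k t) × Bool ≃ N t := fun t => (hk t).some
  let en : (Σ t, Fin (k t)) → Bool → V := fun e b => (f e.1 (e.2, b) : V)
  obtain ⟨L, l1, l2, l3⟩ := trail_decomp en p Finset.univ
  have hen : ∀ e b e' b', e.1 = e'.1 → en e b = en e' b' → e = e' ∧ b = b' := by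
    rintro ⟨t, i⟩ b ⟨t', i'⟩ b' h h'
    dsimp only at h
    subst h
    have := (f t).injective (Subtype.ext h')
    simp only [Prod.mk.injEq] at this
    simp [this.1, this.2]
  refine ⟨L.length, fun j => (L.get j).1.1, fun j b => en (L.get j).1 (xor (L.get j).2 b), ?_, ?_, ?_, ?_⟩
  · intro j b
    exact (hN _ _).1 (f (L.get j).1.1 ((L.get j).1.2, _)).2
  · intro j b j' b' h h'
    obtain ⟨q1, q2⟩ := hen _ _ _ _ h h'
    have : j = j' := by
      have hj := List.nodup_iff_injective_get.1 l1
      have := @hj (Fin.cast (by simp) j) (Fin.cast (by simp) j') (by simpa using q1)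
      simpa [Fin.ext_iff] using this
    subst this
    refine ⟨rfl, ?_⟩
    simpa using q2
  · intro u w hu huw
    obtain ⟨⟨i, b⟩, hib⟩ := (f u).surjective ⟨w, (hN u w).2 ⟨hu, huw⟩⟩
    obtain ⟨a, ha, ha'⟩ := List.mem_map.1 ((l2 ⟨u, i⟩).2 (Finset.mem_univ _))
    obtain ⟨j, rfl⟩ := List.get_of_mem ha
    refine ⟨j, xor (L.get j).2 b, by simp only [ha'], ?_⟩
    dsimp only
    rw [ha', ← Bool.xor_assoc, Bool.xor_self, Bool.false_xor]
    simp [en, hib]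
  · intro v
    convert l3 v using 1
    conv_rhs => rw [← List.ofFn_get L]
    rw [List.map_ofFn]
    congr 1
    funext j
    simp

theorem label_inj (p : ℕ) (i j : ℕ) (b c : Bool)
    (h : pairLab p i + (if b then 2 else 0) = pairLab p j + (if c then 2 else 0)) :
    i = j ∧ b = c := by
  simp only [pairLab] at h
  cases b <;> cases c <;> simp at h ⊢ <;> omega

theorem label_image (p n : ℕ) (hn : 1 ≤ n) :
    (Finset.univ : Finset (Fin n × Bool)).image
      (fun a => pairLab p a.1 + (if a.2 then 2 else 0)) =
      Finset.Icc ((p : ℤ) + 1) ((p : ℤ) + (2 * n : ℕ) - 1) ∪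
        {if (2 * n) % 4 = 0 then (p : ℤ) + (2 * n : ℕ) else (p : ℤ) + (2 * n : ℕ) + 1} := by
  ext x
  simp only [Finset.mem_image, Finset.mem_univ, true_and, Finset.mem_union, Finset.mem_Icc,
    Finset.mem_singleton, Prod.exists, pairLab]
  constructor
  · rintro ⟨⟨j, hj⟩, b, rfl⟩
    cases b <;> simp <;> split_ifs <;> omega
  · rintro (⟨h1, h2⟩ | h)
    · obtain ⟨y, rfl⟩ : ∃ y : ℕ, x = p + 1 + y := ⟨(x - p - 1).toNat, by omega⟩
      by_cases hy : 2 ≤ y % 4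
      · refine ⟨⟨2 * (y / 4) + y % 2, by omega⟩, true, ?_⟩
        simp; omega
      · refine ⟨⟨2 * (y / 4) + y % 2, by omega⟩, false, ?_⟩
        simp; omega
    · refine ⟨⟨n - 1, by omega⟩, true, ?_⟩
      rw [h]
      simp only [if_true]
      split_ifs <;> omega

end helpers

/-- Lemma 2.4: `G[S,T]` bipartite with `m ≥ 1` edges, every vertex of `T` of even degree.
With `δ_m = p+m` if `m ≡ 0 (mod 4)` and `δ_m = p+m+1` if `m ≡ 2 (mod 4)`, there are an
orientation and a bijection onto `{p+1, …, p+m-1} ∪ {δ_m}` with `s(v) = -d_G(v)` on `T` and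
`⌊(d_G(v)-1)/2⌋ - δ_m ≤ s(v) ≤ ⌊(d_G(v)-1)/2⌋ + δ_m` on `S`. -/
theorem bipartite_T_even_orientation
    (G : SimpleGraph V) [DecidableRel G.Adj] (S T : Set V)
    (hpart : S ∪ T = Set.univ) (hdisj : Disjoint S T)
    (hbip : ∀ u v : V, G.Adj u v → (u ∈ S ∧ v ∈ T) ∨ (u ∈ T ∧ v ∈ S))
    (hTeven : ∀ v ∈ T, Even (G.degree v))
    (p m : ℕ) (hm : 1 ≤ m) (hcard : G.edgeFinset.card = m) :
    ∃ A : Finset (V × V), IsOrientation G A ∧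
      ∃ σ : V × V → ℤ, Set.InjOn σ A ∧
        A.image σ =
          Finset.Icc ((p : ℤ) + 1) ((p : ℤ) + m - 1) ∪
            {if m % 4 = 0 then (p : ℤ) + m else (p : ℤ) + m + 1} ∧
        (∀ v ∈ T, orientedSum A σ v = -(G.degree v : ℤ)) ∧
        (∀ v ∈ S,
          ((G.degree v : ℤ) - 1) / 2 -
              (if m % 4 = 0 then (p : ℤ) + m else (p : ℤ) + m + 1) ≤ orientedSum A σ v ∧
          orientedSum A σ v ≤
            ((G.degree v : ℤ) - 1) / 2 +
              (if m % 4 = 0 then (p : ℤ) + m else (p : ℤ) + m + 1)) := by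
  have hST : ∀ v, v ∈ S → v ∈ T → False := fun v h1 h2 => Set.disjoint_left.1 hdisj h1 h2
  obtain ⟨n, t, z, g1, g2, g3, g4⟩ := exists_pairing G T hTeven p
  have gS : ∀ j b, z j b ∈ S := by
    intro j b
    rcases hbip _ _ (g1 j b).2 with h | h
    · exact (hST _ h.1 (g1 j b).1).elim
    · exact h.2
  have hzt : ∀ j b j', z j b ≠ t j' := fun j b j' h =>
    hST _ (gS j b) (h ▸ (g1 j' b).1)
  -- the number of edges
  have hmn : m = 2 * n := by
    rw [← hcard]
    have : (Finset.univ : Finset (Fin n × Bool)).card = G.edgeFinset.card := by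
      refine Finset.card_bij (fun a _ => s(t a.1, z a.1 a.2)) ?_ ?_ ?_
      · intro a _; simpa using (g1 a.1 a.2).2
      · rintro ⟨j, b⟩ _ ⟨j', b'⟩ _ h
        rw [Sym2.eq_iff] at h
        rcases h with h | h
        · obtain ⟨rfl, rfl⟩ := g2 _ _ _ _ h.1 h.2; rfl
        · exact (hzt _ _ _ h.2).elim
      · intro e he
        induction e using Sym2.ind with
        | _ u w =>
        have hadj : G.Adj u w := by simpa using he
        rcases hbip _ _ hadj with h | h
        · obtain ⟨j, b, rfl, rfl⟩ := g3 w u h.2 hadj.symm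
          exact ⟨(j, b), by simp, Sym2.eq_swap⟩
        · obtain ⟨j, b, rfl, rfl⟩ := g3 u w h.1 hadj
          exact ⟨(j, b), by simp, rfl⟩
    rw [← this]; simp; ring
  have hn : 1 ≤ n := by omega
  subst hmn
  let arc : Fin n × Bool → V × V := fun a =>
    if a.2 then (t a.1, z a.1 true) else (z a.1 false, t a.1)
  let lab : Fin n × Bool → ℤ := fun a => pairLab p a.1 + (if a.2 then 2 else 0)
  have harc : Function.Injective arc := by
    rintro ⟨j, b⟩ ⟨j', b'⟩ h
    cases b <;> cases b' <;> simp only [arc, if_true, if_false, Prod.mk.injEq, Bool.false_eq_true] at h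
    · rw [(g2 _ _ _ _ h.2 h.1).1]
    · exact (hzt _ _ _ h.1).elim
    · exact (hzt _ _ _ h.2).elim
    · rw [(g2 _ _ _ _ h.1 h.2).1]
  have hlab : Function.Injective lab := by
    rintro ⟨j, b⟩ ⟨j', b'⟩ h
    obtain ⟨h1, h2⟩ := label_inj p _ _ _ _ h
    exact Prod.ext (Fin.ext h1) h2
  have hext : ∀ a, Function.extend arc lab 0 (arc a) = lab a := fun a => harc.extend_apply _ _ _
  have hsum : ∀ v, orientedSum (Finset.univ.image arc) (Function.extend arc lab 0) v =
      ∑ j : Fin n, (((if t j = v then pairLab p j else 0) +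
        (if z j true = v then pairLab p j + 2 else 0)) -
        ((if z j false = v then pairLab p j else 0) +
        (if t j = v then pairLab p j + 2 else 0))) := by
    intro v
    unfold orientedSum
    rw [Finset.sum_filter, Finset.sum_filter, Finset.sum_image (fun _ _ _ _ h => harc h),
      Finset.sum_image (fun _ _ _ _ h => harc h), Fintype.sum_prod_type, Fintype.sum_prod_type,
      ← Finset.sum_sub_distrib]
    refine Finset.sum_congr rfl fun j _ => ?_
    rw [Fintype.sum_bool, Fintype.sum_bool]
    simp only [hext]
    simp only [arc, lab, if_true, if_false, Bool.false_eq_true, add_zero]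
    ring
  refine ⟨Finset.univ.image arc, ⟨?_, ?_, ?_⟩, Function.extend arc lab 0, ?_, ?_, ?_, ?_⟩
  · intro a ha
    obtain ⟨⟨j, b⟩, -, rfl⟩ := Finset.mem_image.1 ha
    cases b
    · exact (g1 j false).2.symm
    · exact (g1 j true).2
  · intro u v huv
    have key : ∀ j b, (t j, z j b) ∈ Finset.univ.image arc ∨ (z j b, t j) ∈ Finset.univ.image arc := by
      intro j b
      cases b
      · right; exact Finset.mem_image.2 ⟨(j, false), Finset.mem_univ _, rfl⟩
      · left; exact Finset.mem_image.2 ⟨(j, true), Finset.mem_univ _, rfl⟩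
    rcases hbip _ _ huv with h | h
    · obtain ⟨j, b, rfl, rfl⟩ := g3 v u h.2 huv.symm
      exact (key j b).symm
    · obtain ⟨j, b, rfl, rfl⟩ := g3 u v h.1 huv
      exact key j b
  · intro u v h h'
    obtain ⟨⟨j, b⟩, -, h1⟩ := Finset.mem_image.1 h
    obtain ⟨⟨j', b'⟩, -, h2⟩ := Finset.mem_image.1 h'
    cases b <;> cases b' <;>
      simp only [arc, if_true, if_false, Prod.mk.injEq, Bool.false_eq_true] at h1 h2
    · exact hzt _ _ _ (h1.1.trans h2.2.symm)
    · have := (g2 _ _ _ _ (h1.2.trans h2.1.symm) (h1.1.trans h2.2.symm)).2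
      simp at this
    · have := (g2 _ _ _ _ (h1.1.trans h2.2.symm) (h1.2.trans h2.1.symm)).2
      simp at this
    · exact hzt _ _ _ (h1.2.trans h2.1.symm)
  · intro a ha c hc h
    rw [Finset.mem_coe] at ha hc
    obtain ⟨a, -, rfl⟩ := Finset.mem_image.1 ha
    obtain ⟨c, -, rfl⟩ := Finset.mem_image.1 hc
    rw [hext, hext] at h
    rw [hlab h]
  · rw [← label_image p n hn, Finset.image_image]
    congr 1
    funext a
    exact hext a
  · intro v hv
    have hz : ∀ j b, z j b ≠ v := fun j b h => hST v (h ▸ gS j b) hv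
    have hd : G.degree v = ∑ j : Fin n, (if t j = v then 2 else 0) := by
      rw [← G.card_neighborFinset_eq_degree]
      have : ((Finset.univ : Finset (Fin n × Bool)).filter (fun a => t a.1 = v)).card =
          (G.neighborFinset v).card := by
        refine Finset.card_bij (fun a _ => z a.1 a.2) ?_ ?_ ?_
        · intro a ha
          have := (Finset.mem_filter.1 ha).2
          rw [SimpleGraph.mem_neighborFinset, ← this]
          exact (g1 _ _).2
        · rintro ⟨j, b⟩ ha ⟨j', b'⟩ hb h
          have h1 := (Finset.mem_filter.1 ha).2
          have h2 := (Finset.mem_filter.1 hb).2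
          obtain ⟨rfl, rfl⟩ := g2 _ _ _ _ (h1.trans h2.symm) h
          rfl
        · intro w hw
          rw [SimpleGraph.mem_neighborFinset] at hw
          obtain ⟨j, b, h1, h2⟩ := g3 v w hv hw
          exact ⟨(j, b), by simp [h1], h2⟩
      rw [← this, Finset.card_filter, Fintype.sum_prod_type]
      refine Finset.sum_congr rfl fun j _ => ?_
      rw [Fintype.sum_bool]
      dsimp only
      split_ifs <;> rfl
    rw [hsum, hd, Nat.cast_sum, ← Finset.sum_neg_distrib]
    refine Finset.sum_congr rfl fun j _ => ?_
    simp only [hz, if_false]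
    split_ifs <;> simp
  · intro v hv
    have ht : ∀ j, t j ≠ v := fun j h => hST v hv (h ▸ (g1 j true).1)
    have hd : (G.degree v : ℤ) = arcDeg v (List.ofFn fun j => (z j false, z j true)) := by
      rw [arcDeg_ofFn, ← G.card_neighborFinset_eq_degree]
      have : ((Finset.univ : Finset (Fin n × Bool)).filter (fun a => z a.1 a.2 = v)).card =
          (G.neighborFinset v).card := by
        refine Finset.card_bij (fun a _ => t a.1) ?_ ?_ ?_
        · intro a ha
          have := (Finset.mem_filter.1 ha).2
          rw [SimpleGraph.mem_neighborFinset, ← this]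
          exact (g1 _ _).2.symm
        · rintro ⟨j, b⟩ ha ⟨j', b'⟩ hb h
          have h1 := (Finset.mem_filter.1 ha).2
          have h2 := (Finset.mem_filter.1 hb).2
          obtain ⟨rfl, rfl⟩ := g2 _ _ _ _ h (h1.trans h2.symm)
          rfl
        · intro w hw
          rw [SimpleGraph.mem_neighborFinset] at hw
          have hwT : w ∈ T := by
            rcases hbip _ _ hw with h | h
            · exact h.2
            · exact (hST v hv h.1).elim
          obtain ⟨j, b, h1, h2⟩ := g3 w v hwT hw.symm
          exact ⟨(j, b), by simp [h2], h1⟩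
      rw [← this, Finset.card_filter, Fintype.sum_prod_type, Nat.cast_sum]
      refine Finset.sum_congr rfl fun j _ => ?_
      rw [Fintype.sum_bool]
      push_cast
      rfl
    have hs : orientedSum (Finset.univ.image arc) (Function.extend arc lab 0) v =
        arcSum p v 0 (List.ofFn fun j => (z j false, z j true)) := by
      rw [hsum, arcSum_ofFn]
      refine Finset.sum_congr rfl fun j _ => ?_
      simp only [ht, if_false, zero_add, add_zero]
    rw [hs, hd]
    refine arcInv_bound p v _ (g4 v) _ (by simpa using hn) ?_
    rw [List.length_ofFn]
    split_ifs <;> push_cast <;> omega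
end
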